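/- Every triangulation of the Klein bottle N_2 has a nonseparating cycle which is one-sided and nonorientable-leaving, and also a nonseparating cycle which is two-sided and orientable-leaving. -/

import Mathlib

open scoped Classical

/-- A combinatorial triangulation of a closed surface: a finite set of triangular
faces (3-element subsets of `ℕ`) such that every edge lies in exactly two faces,
the faces around each vertex form a single cycle (the link condition), and the
whole complex is connected.  The underlying simple graph has as edges the
2-element subsets of faces. -/
structure Triangulation where
  faces : Finset (Finset ℕ)
  faces_nonempty : faces.Nonempty
  card_eq_three : ∀ f ∈ faces, f.card = 3
  edge_in_two_faces : ∀ e : Finset ℕ, e.card = 2 → (∃ f ∈ faces, e ⊆ f) →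
    (faces.filter (fun f => e ⊆ f)).card = 2
  link_connected : ∀ v : ℕ, ∀ f ∈ faces, ∀ g ∈ faces, v ∈ f → v ∈ g →
    Relation.ReflTransGen
      (fun f' g' => f' ∈ faces ∧ g' ∈ faces ∧ v ∈ f' ∧ v ∈ g' ∧ (f' ∩ g').card = 2) f g
  face_connected : ∀ f ∈ faces, ∀ g ∈ faces,
    Relation.ReflTransGen
      (fun f' g' => f' ∈ faces ∧ g' ∈ faces ∧ (f' ∩ g').card = 2) f g

namespace Triangulation

/-- The vertices spanned by a set of faces. -/
def vertsOf (F : Finset (Finset ℕ)) : Finset ℕ := F.sup id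

/-- The edges spanned by a set of triangular faces: all 2-element subsets of faces. -/
def edgesOf (F : Finset (Finset ℕ)) : Finset (Finset ℕ) :=
  (Finset.powersetCard 2 (vertsOf F)).filter (fun e => ∃ f ∈ F, e ⊆ f)

/-- The vertex set of a triangulation. -/
def verts (T : Triangulation) : Finset ℕ := vertsOf T.faces

/-- The edge set of a triangulation. -/
def edges (T : Triangulation) : Finset (Finset ℕ) := edgesOf T.faces

/-- The Euler characteristic `V - E + F` of a triangulation. -/
def euler (T : Triangulation) : ℤ :=
  (T.verts.card : ℤ) - (T.edges.card : ℤ) + (T.faces.card : ℤ)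

/-- The three directed edges of an ordered triple (an oriented triangle). -/
def dedges (t : ℕ × ℕ × ℕ) : Finset (ℕ × ℕ) :=
  {(t.1, t.2.1), (t.2.1, t.2.2), (t.2.2, t.1)}

/-- `σ` is a coherent orientation of the set `F` of triangular faces: it assigns to each
face an oriented triangle with that vertex set, so that no directed edge is used twice
(equivalently, the two faces sharing an edge traverse that edge in opposite directions). -/
def IsCoherent (F : Finset (Finset ℕ)) (σ : Finset ℕ → ℕ × ℕ × ℕ) : Prop :=
  (∀ f ∈ F, ({(σ f).1, (σ f).2.1, (σ f).2.2} : Finset ℕ) = f) ∧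
  (∀ f ∈ F, ∀ g ∈ F, f ≠ g → Disjoint (dedges (σ f)) (dedges (σ g)))

/-- A triangulation is orientable if its faces admit a coherent orientation. -/
def Orientable (T : Triangulation) : Prop := ∃ σ, IsCoherent T.faces σ

/-- `T` is a triangulation of the orientable surface `S_g` of genus `g`
(Euler characteristic `2 - 2g`). -/
def IsS (g : ℕ) (T : Triangulation) : Prop :=
  T.euler = 2 - 2 * (g : ℤ) ∧ T.Orientable

/-- `T` is a triangulation of the nonorientable surface `N_g` of genus `g`
(Euler characteristic `2 - g`). -/
def IsN (g : ℕ) (T : Triangulation) : Prop :=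
  T.euler = 2 - (g : ℤ) ∧ ¬ T.Orientable

/-- The edges of the cyclic vertex sequence `c`. -/
def cycEdges (c : List ℕ) : Finset (Finset ℕ) :=
  (Finset.range c.length).image
    (fun i => ({c.getD i 0, c.getD ((i + 1) % c.length) 0} : Finset ℕ))

/-- `c` is a cycle of the triangulation `T`: at least three distinct vertices,
consecutive ones (cyclically) joined by edges of `T`. -/
def IsCycle (T : Triangulation) (c : List ℕ) : Prop :=
  3 ≤ c.length ∧ c.Nodup ∧ ∀ e ∈ cycEdges c, e ∈ T.edges

/-- Faces `f` and `g` lie in the same component of `S - C`, where `C` is the closed curve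
corresponding to the cycle `c`: they are joined by a chain of faces consecutively sharing
edges that are not edges of the cycle. -/
def SameSide (T : Triangulation) (c : List ℕ) (f g : Finset ℕ) : Prop :=
  Relation.ReflTransGen
    (fun f' g' => f' ∈ T.faces ∧ g' ∈ T.faces ∧ (f' ∩ g').card = 2 ∧
      f' ∩ g' ∉ cycEdges c) f g

/-- The cycle `c` separates the surface: `S - C` is disconnected. -/
def Separating (T : Triangulation) (c : List ℕ) : Prop :=
  ∃ f ∈ T.faces, ∃ g ∈ T.faces, ¬ SameSide T c f g

/-- The faces in the component of `S - C` containing the face `f`. -/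
noncomputable def sideFaces (T : Triangulation) (c : List ℕ) (f : Finset ℕ) :
    Finset (Finset ℕ) :=
  T.faces.filter (fun g => SameSide T c f g)

/-- The Euler characteristic of the component of `f` in the surface cut along the cycle
`c`, capped with a single new face (`+1`). -/
noncomputable def sideEuler (T : Triangulation) (c : List ℕ) (f : Finset ℕ) : ℤ :=
  ((vertsOf (sideFaces T c f)).card : ℤ) - ((edgesOf (sideFaces T c f)).card : ℤ)
    + ((sideFaces T c f).card : ℤ) + 1

/-- The Euler genus `2 - χ` of the capped component of `f` in the surface cut
along the cycle `c`. -/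
noncomputable def sideEulerGenus (T : Triangulation) (c : List ℕ) (f : Finset ℕ) : ℤ :=
  2 - sideEuler T c f

/-- The capped component of `f` in the surface cut along the cycle `c` is orientable. -/
def SideOrientable (T : Triangulation) (c : List ℕ) (f : Finset ℕ) : Prop :=
  ∃ σ, IsCoherent (sideFaces T c f) σ

/-- `c` is a noncontractible separating cycle (NSC): it separates the surface and
neither capped component is a triangulation of the sphere (`χ = 2`). -/
def IsNSC (T : Triangulation) (c : List ℕ) : Prop :=
  IsCycle T c ∧ Separating T c ∧ ∀ f ∈ T.faces, sideEuler T c f ≠ 2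

/-- A coherent orientation of the faces of `T` in which the gluing across the edges of the
cycle `c` is ignored: this orients the surface obtained by cutting along `c`. -/
def IsCutCoherent (T : Triangulation) (c : List ℕ) (σ : Finset ℕ → ℕ × ℕ × ℕ) : Prop :=
  (∀ f ∈ T.faces, ({(σ f).1, (σ f).2.1, (σ f).2.2} : Finset ℕ) = f) ∧
  (∀ f ∈ T.faces, ∀ g ∈ T.faces, f ≠ g → f ∩ g ∉ cycEdges c →
    Disjoint (dedges (σ f)) (dedges (σ g)))

/-- The cycle `c` is orientable-leaving: the surface obtained by cutting along `c`
is orientable. -/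
def OrientableLeaving (T : Triangulation) (c : List ℕ) : Prop :=
  ∃ σ, IsCutCoherent T c σ

/-- A corner of the cycle `c`: a pair `(i, f)` where `f` is a face containing the `i`-th
vertex of `c`. -/
def IsCorner (T : Triangulation) (c : List ℕ) (x : ℕ × Finset ℕ) : Prop :=
  x.1 < c.length ∧ x.2 ∈ T.faces ∧ c.getD x.1 0 ∈ x.2

/-- Two corners lie on a common boundary segment of the surface cut along `c`:
either they are corners at the same cycle vertex whose faces share an edge through that
vertex not lying on the cycle, or they are corners of one face containing a cycle edge,
at the two endpoints of that edge. -/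
def CornerRel (T : Triangulation) (c : List ℕ) (x y : ℕ × Finset ℕ) : Prop :=
  IsCorner T c x ∧ IsCorner T c y ∧
  ((x.1 = y.1 ∧ (x.2 ∩ y.2).card = 2 ∧ c.getD x.1 0 ∈ x.2 ∩ y.2 ∧
      x.2 ∩ y.2 ∉ cycEdges c) ∨
    (y.1 = (x.1 + 1) % c.length ∧ x.2 = y.2 ∧
      ({c.getD x.1 0, c.getD y.1 0} : Finset ℕ) ⊆ x.2))

/-- The cycle `c` is one-sided: cutting the surface along `c` produces a single boundary
cycle, i.e. all corners along `c` lie on one boundary component (the neighborhood of the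
curve is a Möbius band).  A nonseparating cycle is two-sided iff it is not one-sided. -/
def OneSided (T : Triangulation) (c : List ℕ) : Prop :=
  ∀ x y, IsCorner T c x → IsCorner T c y → Relation.EqvGen (CornerRel T c) x y

/-- The 3-cycles (triangles) of the graph of `T`. -/
def triangles (T : Triangulation) : Finset (Finset ℕ) :=
  (Finset.powersetCard 3 T.verts).filter
    (fun t => ∀ e ∈ Finset.powersetCard 2 t, e ∈ T.edges)

/-- An edge of `T` is contractible iff it lies in exactly two 3-cycles of the graph of
`T` (for any triangulation other than `K₄` on the sphere, this is equivalent to the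
contraction of the edge yielding again a triangulation of the same surface). -/
def ContractibleEdge (T : Triangulation) (e : Finset ℕ) : Prop :=
  e ∈ T.edges ∧ (T.triangles.filter (fun t => e ⊆ t)).card = 2

/-- A triangulation is irreducible if it has no contractible edge. -/
def Irreducible (T : Triangulation) : Prop :=
  ∀ e, ¬ ContractibleEdge T e

/-- Two face sets are equivalent if some relabelling of the vertices carries one onto the
other (such a bijection carries faces to faces and hence edges to edges). -/
def FacesEquiv (F F' : Finset (Finset ℕ)) : Prop :=
  ∃ φ : ℕ ≃ ℕ, F' = F.image (fun f => f.image φ)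

/-- Two triangulations are equivalent if some vertex bijection carries faces to faces
(and hence edges to edges). -/
def EquivTri (T T' : Triangulation) : Prop := FacesEquiv T.faces T'.faces

/-- `T'` is obtained from `T` by a diagonal flip: the edge `{a,c}`, lying in the faces
`{a,b,c}` and `{a,c,d}` with `{b,d}` not an edge, is replaced by `{b,d}` and the two
faces by `{a,b,d}` and `{b,c,d}`. -/
def Flip (T T' : Triangulation) : Prop :=
  ∃ a b c d : ℕ, ({a, b, c} : Finset ℕ) ∈ T.faces ∧ ({a, c, d} : Finset ℕ) ∈ T.faces ∧
    b ≠ d ∧ ({b, d} : Finset ℕ) ∉ T.edges ∧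
    T'.faces = (T.faces \ {({a, b, c} : Finset ℕ), ({a, c, d} : Finset ℕ)}) ∪
      {({a, b, d} : Finset ℕ), ({b, c, d} : Finset ℕ)}

/-- Two triangulations are equivalent under diagonal flips if a finite sequence of
diagonal flips transforms one into a triangulation equivalent to the other. -/
def FlipEquiv (T T' : Triangulation) : Prop :=
  ∃ T'' : Triangulation, Relation.ReflTransGen Flip T T'' ∧ EquivTri T'' T'

end Triangulation

namespace Triangulation


/-- `u`, `v`, `w` are the three vertices of a face of `T`. -/
def IsFace (T : Triangulation) (u v w : ℕ) : Prop := ({u, v, w} : Finset ℕ) ∈ T.faces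

section Basic

variable {T : Triangulation} {u v w w' : ℕ}

theorem IsFace.rot (h : T.IsFace u v w) : T.IsFace v w u := by
  unfold IsFace at *
  convert h using 1
  ext; simp; tauto

theorem IsFace.swap (h : T.IsFace u v w) : T.IsFace v u w := by
  unfold IsFace at *
  convert h using 1
  ext; simp; tauto

theorem IsFace.ne (h : T.IsFace u v w) : u ≠ v := by
  rintro rfl
  have h3 := T.card_eq_three _ h
  rw [Finset.insert_eq_of_mem (by simp)] at h3
  have := Finset.card_le_two (a := u) (b := w)
  omega

theorem exists_isFace {f : Finset ℕ} (hf : f ∈ T.faces) :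
    ∃ u v w, f = {u, v, w} ∧ T.IsFace u v w := by
  obtain ⟨u, v, w, -, -, -, rfl⟩ := Finset.card_eq_three.1 (T.card_eq_three f hf)
  exact ⟨u, v, w, rfl, hf⟩

theorem exists_isFace_of_mem {f : Finset ℕ} (hf : f ∈ T.faces) (hu : u ∈ f) :
    ∃ v w, f = {u, v, w} ∧ T.IsFace u v w := by
  obtain ⟨a, b, c, rfl, h⟩ := exists_isFace hf
  simp only [Finset.mem_insert, Finset.mem_singleton] at hu
  rcases hu with rfl | rfl | rfl
  · exact ⟨b, c, rfl, h⟩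
  · exact ⟨c, a, by ext; simp; tauto, h.rot⟩
  · exact ⟨a, b, by ext; simp; tauto, h.rot.rot⟩

theorem exists_isFace_of_mem_of_mem {f : Finset ℕ} (hf : f ∈ T.faces) (hu : u ∈ f) (hv : v ∈ f)
    (huv : u ≠ v) : ∃ w, f = {u, v, w} ∧ T.IsFace u v w := by
  obtain ⟨a, b, rfl, h⟩ := exists_isFace_of_mem hf hu
  simp only [Finset.mem_insert, Finset.mem_singleton] at hv
  rcases hv with rfl | rfl | rfl
  · exact absurd rfl huv
  · exact ⟨b, rfl, h⟩
  · exact ⟨a, by ext; simp; tauto, h.rot.rot.swap⟩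

theorem mem_edges {e : Finset ℕ} : e ∈ T.edges ↔ e.card = 2 ∧ ∃ f ∈ T.faces, e ⊆ f := by
  unfold edges edgesOf vertsOf
  simp only [Finset.mem_filter, Finset.mem_powersetCard]
  constructor
  · rintro ⟨⟨-, h⟩, h'⟩
    exact ⟨h, h'⟩
  · rintro ⟨h, f, hf, hef⟩
    exact ⟨⟨hef.trans (Finset.le_sup (f := id) hf), h⟩, f, hf, hef⟩

theorem pair_mem_edges : ({u, v} : Finset ℕ) ∈ T.edges ↔ ∃ w, T.IsFace u v w := by
  rw [mem_edges]
  constructor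
  · rintro ⟨h2, f, hf, hef⟩
    have huv : u ≠ v := by
      rintro rfl
      simp at h2
    obtain ⟨w, -, h⟩ := exists_isFace_of_mem_of_mem hf (hef (by simp)) (hef (by simp)) huv
    exact ⟨w, h⟩
  · rintro ⟨w, h⟩
    refine ⟨Finset.card_pair h.ne, _, h, ?_⟩
    intro x
    simp only [Finset.mem_insert, Finset.mem_singleton]
    tauto

theorem exists_pair_of_mem_edges {e : Finset ℕ} (he : e ∈ T.edges) :
    ∃ u v w, e = {u, v} ∧ T.IsFace u v w := by
  obtain ⟨u, v, -, rfl⟩ := Finset.card_eq_two.1 (mem_edges.1 he).1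
  obtain ⟨w, h⟩ := pair_mem_edges.1 he
  exact ⟨u, v, w, rfl, h⟩

theorem mem_verts : u ∈ T.verts ↔ ∃ f ∈ T.faces, u ∈ f := by
  simp [verts, vertsOf, Finset.mem_sup]

theorem IsFace.mem_verts (h : T.IsFace u v w) : u ∈ T.verts :=
  Triangulation.mem_verts.2 ⟨_, h, by simp⟩

theorem IsFace.third_eq_of_eq (h : T.IsFace u v w)
    (he : ({u, v, w} : Finset ℕ) = {u, v, w'}) : w = w' := by
  have h1 := h.rot.ne
  have h2 := h.rot.rot.ne
  have : w ∈ ({u, v, w'} : Finset ℕ) := by rw [← he]; simp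
  simp only [Finset.mem_insert, Finset.mem_singleton] at this
  grind

theorem filter_pair_subset (h : T.IsFace u v w) (h' : T.IsFace u v w') (hw : w ≠ w') :
    T.faces.filter (fun f => ({u, v} : Finset ℕ) ⊆ f) = {{u, v, w}, {u, v, w'}} := by
  symm
  apply Finset.eq_of_subset_of_card_le
  · intro f hf
    simp only [Finset.mem_insert, Finset.mem_singleton] at hf
    rcases hf with rfl | rfl
    · exact Finset.mem_filter.2 ⟨h, by intro x; simp; tauto⟩
    · exact Finset.mem_filter.2 ⟨h', by intro x; simp; tauto⟩
  · rw [T.edge_in_two_faces _ (Finset.card_pair h.ne) ⟨_, h, by intro x; simp; tauto⟩,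
      Finset.card_pair fun he => hw (h.third_eq_of_eq he)]

theorem IsFace.exists_opposite (h : T.IsFace u v w) : ∃ x, x ≠ w ∧ T.IsFace u v x := by
  have h2 := T.edge_in_two_faces {u, v} (Finset.card_pair h.ne)
    ⟨_, h, by intro x; simp; tauto⟩
  obtain ⟨g, hg, hne⟩ := Finset.exists_mem_ne (by rw [h2]; omega) ({u, v, w} : Finset ℕ)
  rw [Finset.mem_filter] at hg
  obtain ⟨x, rfl, hx⟩ := exists_isFace_of_mem_of_mem hg.1 (hg.2 (by simp : u ∈ _))
    (hg.2 (by simp : v ∈ _)) h.ne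
  exact ⟨x, by rintro rfl; exact hne rfl, hx⟩

theorem IsFace.eq_or_eq {x : ℕ} (h : T.IsFace u v w) (h' : T.IsFace u v w') (hw : w ≠ w')
    (hx : T.IsFace u v x) : x = w ∨ x = w' := by
  have : ({u, v, x} : Finset ℕ) ∈ T.faces.filter (fun f => ({u, v} : Finset ℕ) ⊆ f) :=
    Finset.mem_filter.2 ⟨hx, by intro x; simp; tauto⟩
  rw [filter_pair_subset h h' hw, Finset.mem_insert, Finset.mem_singleton] at this
  exact this.imp hx.third_eq_of_eq hx.third_eq_of_eq

theorem IsFace.inter_eq (h : T.IsFace u v w) (hw : w ≠ w') :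
    ({u, v, w} ∩ {u, v, w'} : Finset ℕ) = {u, v} := by
  have h1 := h.rot.ne
  have h2 := h.rot.rot.ne
  ext x
  simp only [Finset.mem_inter, Finset.mem_insert, Finset.mem_singleton]
  grind

theorem exists_of_card_inter {f g : Finset ℕ} (hf : f ∈ T.faces) (hg : g ∈ T.faces)
    (hfg : (f ∩ g).card = 2) : ∃ u v w w', f = {u, v, w} ∧ g = {u, v, w'} ∧ T.IsFace u v w ∧
      T.IsFace u v w' ∧ w ≠ w' ∧ f ∩ g = {u, v} := by
  obtain ⟨u, v, huv, he⟩ := Finset.card_eq_two.1 hfg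
  have hu : u ∈ f ∩ g := by rw [he]; simp
  have hv : v ∈ f ∩ g := by rw [he]; simp
  rw [Finset.mem_inter] at hu hv
  obtain ⟨w, rfl, h⟩ := exists_isFace_of_mem_of_mem hf hu.1 hv.1 huv
  obtain ⟨w', rfl, h'⟩ := exists_isFace_of_mem_of_mem hg hu.2 hv.2 huv
  refine ⟨u, v, w, w', rfl, rfl, h, h', ?_, he⟩
  rintro rfl
  rw [Finset.inter_self, T.card_eq_three _ h] at hfg
  omega

theorem exists_of_card_inter_of_mem {f g : Finset ℕ} (hf : f ∈ T.faces) (hg : g ∈ T.faces)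
    (hfg : (f ∩ g).card = 2) (hu : u ∈ f) (hu' : u ∈ g) :
    ∃ v w w', f = {u, v, w} ∧ g = {u, v, w'} ∧ T.IsFace u v w ∧
      T.IsFace u v w' ∧ w ≠ w' ∧ f ∩ g = {u, v} := by
  obtain ⟨a, b, w, w', rfl, rfl, h, h', hw, he⟩ := exists_of_card_inter hf hg hfg
  have : u ∈ ({a, b, w} ∩ {a, b, w'} : Finset ℕ) := Finset.mem_inter.2 ⟨hu, hu'⟩
  rw [he, Finset.mem_insert, Finset.mem_singleton] at this
  rcases this with rfl | rfl
  · exact ⟨b, w, w', rfl, rfl, h, h', hw, he⟩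
  · exact ⟨a, w, w', by rw [Finset.insert_comm], by rw [Finset.insert_comm], h.swap, h'.swap, hw,
      by rw [he, Finset.pair_comm]⟩

theorem face_induction {P : Finset ℕ → Prop} {f : Finset ℕ} (hf : f ∈ T.faces) (hP : P f)
    (step : ∀ u v w w', T.IsFace u v w → T.IsFace u v w' → w ≠ w' → P {u, v, w} → P {u, v, w'})
    {g : Finset ℕ} (hg : g ∈ T.faces) : P g := by
  induction T.face_connected f hf g hg with
  | refl => exact hP
  | tail _ h ih =>
    obtain ⟨h1, h2, h3⟩ := h
    obtain ⟨u, v, w, w', rfl, rfl, h, h', hw, -⟩ := exists_of_card_inter h1 h2 h3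
    exact step u v w w' h h' hw (ih h1)

theorem link_induction {v a b : ℕ} {P : ℕ → ℕ → Prop} (hf : T.IsFace v a b) (hP : P a b)
    (symm : ∀ x y, T.IsFace v x y → P x y → P y x)
    (step : ∀ x y z, T.IsFace v x y → T.IsFace v x z → y ≠ z → P x y → P x z)
    {c d : ℕ} (hg : T.IsFace v c d) : P c d := by
  have key : ∀ g ∈ T.faces, v ∈ g → ∀ x y, g = {v, x, y} → P x y := by
    intro g hg hvg
    have uniq : ∀ a b : ℕ, T.IsFace v a b → P a b → ∀ x y, ({v, a, b} : Finset ℕ) = {v, x, y} →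
        P x y := by
      intro a b h hP x y he
      have hx : x ∈ ({v, a, b} : Finset ℕ) := by rw [he]; simp
      have hv : T.IsFace v x y := by unfold IsFace; rwa [← he]
      have h1 := hv.ne
      simp only [Finset.mem_insert, Finset.mem_singleton] at hx
      rcases hx with rfl | rfl | rfl
      · exact absurd rfl h1
      · obtain rfl := h.third_eq_of_eq he
        exact hP
      · have : a = y := h.rot.rot.swap.third_eq_of_eq (by rw [← he]; ext; simp; tauto)
        subst this
        exact symm _ _ h hP
    induction T.link_connected v _ hf g hg (by simp) hvg with
    | refl => exact uniq a b hf hP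
    | tail _ h ih =>
      obtain ⟨h1, h2, h3, h4, h5⟩ := h
      obtain ⟨x, y, z, rfl, rfl, h, h', hw, -⟩ := exists_of_card_inter_of_mem h1 h2 h5 h3 h4
      exact uniq x z h' (step x y z h h' hw (ih h1 h3 _ _ rfl))
  exact key _ hg (by simp) c d rfl

end Basic


section Cycles

variable {T : Triangulation} {c : List ℕ}

theorem mem_cycEdges {e : Finset ℕ} : e ∈ cycEdges c ↔
    ∃ i < c.length, ({c.getD i 0, c.getD ((i + 1) % c.length) 0} : Finset ℕ) = e := by
  simp [cycEdges]

theorem pair_mem_cycEdges {i : ℕ} (hi : i < c.length) :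
    ({c.getD i 0, c.getD ((i + 1) % c.length) 0} : Finset ℕ) ∈ cycEdges c :=
  mem_cycEdges.2 ⟨i, hi, rfl⟩

theorem getD_inj (hc : c.Nodup) {i j : ℕ} (hi : i < c.length) (hj : j < c.length)
    (h : c.getD i 0 = c.getD j 0) : i = j := by
  rw [List.getD_eq_getElem _ _ hi, List.getD_eq_getElem _ _ hj] at h
  exact (hc.getElem_inj_iff).1 h

theorem succ_mod_cases {i n : ℕ} (hi : i < n) :
    (i + 1 < n ∧ (i + 1) % n = i + 1) ∨ (i + 1 = n ∧ (i + 1) % n = 0) := by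
  rcases Nat.lt_or_ge (i + 1) n with h | h
  · exact Or.inl ⟨h, Nat.mod_eq_of_lt h⟩
  · have : i + 1 = n := by omega
    exact Or.inr ⟨this, by rw [this, Nat.mod_self]⟩

theorem pair_eq_pair_cases {a b x y : ℕ} (h : ({a, b} : Finset ℕ) = {x, y}) :
    (a = x ∧ b = y) ∨ (a = y ∧ b = x) := by
  have h1 : a ∈ ({x, y} : Finset ℕ) := by rw [← h]; simp
  have h2 : b ∈ ({x, y} : Finset ℕ) := by rw [← h]; simp
  have h3 : x ∈ ({a, b} : Finset ℕ) := by rw [h]; simp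
  have h4 : y ∈ ({a, b} : Finset ℕ) := by rw [h]; simp
  simp only [Finset.mem_insert, Finset.mem_singleton] at h1 h2 h3 h4
  grind

theorem cycle_pair_injOn (hc : c.Nodup) (h3 : 3 ≤ c.length) :
    Set.InjOn (fun i => ({c.getD i 0, c.getD ((i + 1) % c.length) 0} : Finset ℕ))
      (Finset.range c.length) := by
  intro i hi j hj h
  simp only [Finset.coe_range, Set.mem_Iio] at hi hj
  have hn : 0 < c.length := by omega
  rcases pair_eq_pair_cases h with ⟨h1, -⟩ | ⟨h1, h2⟩
  · exact getD_inj hc hi hj h1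
  · have e1 := getD_inj hc hi (Nat.mod_lt _ hn) h1
    have e2 := getD_inj hc (Nat.mod_lt _ hn) hj h2
    rcases succ_mod_cases hi with h4 | h4 <;> rcases succ_mod_cases hj with h5 | h5 <;> omega

theorem sum_cycEdges {M : Type*} [AddCommMonoid M] (hc : T.IsCycle c) (g : Finset ℕ → M) :
    ∑ e ∈ cycEdges c, g e =
      ∑ i ∈ Finset.range c.length, g {c.getD i 0, c.getD ((i + 1) % c.length) 0} :=
  Finset.sum_image (cycle_pair_injOn hc.2.1 hc.1)

theorem card_cycEdges (hc : T.IsCycle c) : (cycEdges c).card = c.length := by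
  rw [cycEdges, Finset.card_image_of_injOn (cycle_pair_injOn hc.2.1 hc.1), Finset.card_range]

theorem mem_list_iff_getD {x : ℕ} : x ∈ c ↔ ∃ i < c.length, c.getD i 0 = x := by
  rw [List.mem_iff_getElem]
  constructor
  · rintro ⟨i, hi, rfl⟩
    exact ⟨i, hi, List.getD_eq_getElem _ _ hi⟩
  · rintro ⟨i, hi, rfl⟩
    exact ⟨i, hi, (List.getD_eq_getElem _ _ hi).symm⟩

theorem mem_of_mem_cycEdges {e : Finset ℕ} {x : ℕ} (he : e ∈ cycEdges c) (hx : x ∈ e) :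
    x ∈ c := by
  obtain ⟨i, hi, rfl⟩ := mem_cycEdges.1 he
  rw [mem_list_iff_getD]
  simp only [Finset.mem_insert, Finset.mem_singleton] at hx
  rcases hx with rfl | rfl
  · exact ⟨i, hi, rfl⟩
  · exact ⟨_, Nat.mod_lt _ (by omega), rfl⟩

theorem eq_of_pair_mem_cycEdges (hc : c.Nodup) {i x : ℕ} (hi : i < c.length)
    (h : ({c.getD i 0, x} : Finset ℕ) ∈ cycEdges c) :
    x = c.getD ((i + 1) % c.length) 0 ∨
      ∃ j < c.length, (j + 1) % c.length = i ∧ x = c.getD j 0 := by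
  obtain ⟨j, hj, he⟩ := mem_cycEdges.1 h
  rcases pair_eq_pair_cases he with ⟨h1, h2⟩ | ⟨h1, h2⟩
  · obtain rfl := getD_inj hc hj hi h1
    exact Or.inl h2.symm
  · exact Or.inr ⟨j, hj, getD_inj hc (Nat.mod_lt _ (by omega)) hi h2, h1.symm⟩

theorem exists_pred_mod {i n : ℕ} (hi : i < n) : ∃ j < n, (j + 1) % n = i := by
  rcases Nat.eq_zero_or_pos i with rfl | h
  · exact ⟨n - 1, by omega, by rw [Nat.sub_add_cancel (by omega), Nat.mod_self]⟩
  · exact ⟨i - 1, by omega, by rw [Nat.sub_add_cancel h, Nat.mod_eq_of_lt hi]⟩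

/-- The sum of the labels `m` along the cyclic vertex sequence `c`. -/
def cycSum {M : Type*} [AddCommMonoid M] (m : ℕ → ℕ → M) (c : List ℕ) : M :=
  ∑ i ∈ Finset.range c.length, m (c.getD i 0) (c.getD ((i + 1) % c.length) 0)

/-- `l` lists the vertices of a path from `u` to `w` with edges in `H`, and `k` is the sum of the
labels `m` along this path. -/
inductive LabelledPath {M : Type*} [AddCommMonoid M] (m : ℕ → ℕ → M) (H : Finset (Finset ℕ)) :
    ℕ → ℕ → List ℕ → M → Prop
  | single (u : ℕ) : LabelledPath m H u u [u] 0
  | cons {u v w : ℕ} {l : List ℕ} {k : M} : ({u, v} : Finset ℕ) ∈ H → u ∉ l →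
      LabelledPath m H v w l k → LabelledPath m H u w (u :: l) (m u v + k)

namespace LabelledPath

variable {M : Type*} [AddCommGroup M] {m : ℕ → ℕ → M} {H H' : Finset (Finset ℕ)}
  {u v w x : ℕ} {l l' : List ℕ} {k k' : M}

theorem mono (h : LabelledPath m H u w l k) (hH : H ⊆ H') : LabelledPath m H' u w l k := by
  induction h with
  | single u => exact single u
  | cons h1 h2 _ ih => exact cons (hH h1) h2 ih

theorem mem (h : LabelledPath m H u w l k) (hx : x ∈ l) : x = w ∨ ∃ e ∈ H, x ∈ e := by
  induction h with
  | single u => exact Or.inl (by simpa using hx)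
  | cons h1 h2 _ ih =>
    rcases List.mem_cons.1 hx with rfl | hx
    · exact Or.inr ⟨_, h1, by simp⟩
    · exact ih hx

theorem append {v' : ℕ} (h : LabelledPath m H u v l k) (h' : LabelledPath m H v' w l' k')
    (he : ({v, v'} : Finset ℕ) ∈ H) (hl : ∀ x ∈ l, x ∉ l') :
    LabelledPath m H u w (l ++ l') (k + m v v' + k') := by
  induction h with
  | single u =>
    rw [zero_add]
    exact cons he (hl u (by simp)) h'
  | cons h1 h2 _ ih =>
    have := cons h1 (by
      rw [List.mem_append, not_or]
      exact ⟨h2, hl _ (by simp)⟩) (ih he fun x hx => hl x (List.mem_cons_of_mem _ hx))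
    simpa only [add_assoc, List.cons_append] using this

theorem reverse (hm : ∀ u v, m u v = m v u) (h : LabelledPath m H u w l k) :
    LabelledPath m H w u l.reverse k := by
  induction h with
  | single u => exact single u
  | @cons u v w l k h1 h2 _ ih =>
    have := ih.append (single u) (by rwa [Finset.pair_comm]) (by
      intro x hx hx'
      rw [List.mem_singleton] at hx'
      subst hx'
      exact h2 (List.mem_reverse.1 hx))
    rw [List.reverse_cons]
    convert this using 1
    rw [hm v u]
    abel

theorem length_pos (h : LabelledPath m H u w l k) : 0 < l.length := by
  cases h <;> simp

theorem getD_zero (h : LabelledPath m H u w l k) : l.getD 0 0 = u := by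
  cases h <;> simp

theorem spec (h : LabelledPath m H u w l k) : l.Nodup ∧ l.getD (l.length - 1) 0 = w ∧
    (∀ i, i + 1 < l.length → ({l.getD i 0, l.getD (i + 1) 0} : Finset ℕ) ∈ H) ∧
    k = ∑ i ∈ Finset.range (l.length - 1), m (l.getD i 0) (l.getD (i + 1) 0) := by
  induction h with
  | single u => simp
  | @cons u v w l k h1 h2 h ih =>
    obtain ⟨i1, i2, i3, i4⟩ := ih
    have hpos := h.length_pos
    obtain ⟨n, hn⟩ : ∃ n, l.length = n + 1 := ⟨l.length - 1, by omega⟩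
    refine ⟨List.nodup_cons.2 ⟨h2, i1⟩, ?_, ?_, ?_⟩
    · rw [hn] at i2
      simpa [hn] using i2
    · rintro (_ | i) hi
      · change ({u, l.getD 0 0} : Finset ℕ) ∈ _
        rwa [h.getD_zero]
      · simpa using i3 i (by simpa using hi)
    · rw [i4, List.length_cons, hn]
      simp only [Nat.add_sub_cancel, Finset.sum_range_succ', List.getD_cons_succ,
        List.getD_cons_zero, h.getD_zero]
      rw [add_comm]

theorem exists_cycle (h : LabelledPath m H u w l k) (huw : u ≠ w) (hH : H ⊆ T.edges)
    (he : ({w, u} : Finset ℕ) ∈ T.edges) (he' : ({u, w} : Finset ℕ) ∉ H) :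
    T.IsCycle l ∧ cycSum m l = k + m w u := by
  obtain ⟨h1, h2, h3, h4⟩ := h.spec
  have h0 := h.getD_zero
  have hpos := h.length_pos
  have hlen : 3 ≤ l.length := by
    by_contra hlt
    have : l.length = 1 ∨ l.length = 2 := by omega
    rcases this with hl | hl
    · rw [hl] at h2
      exact huw (h0.symm.trans h2)
    · have := h3 0 (by omega)
      rw [hl] at h2
      simp only [Nat.reduceSub] at h2
      rw [h0, zero_add, h2] at this
      exact he' this
  refine ⟨⟨hlen, h1, ?_⟩, ?_⟩
  · intro e hmem
    obtain ⟨i, hi, rfl⟩ := mem_cycEdges.1 hmem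
    rcases succ_mod_cases hi with ⟨h5, h6⟩ | ⟨h5, h6⟩
    · rw [h6]
      exact hH (h3 i h5)
    · rw [h6, h0, show i = l.length - 1 by omega, h2]
      exact he
  · obtain ⟨n, hn⟩ : ∃ n, l.length = n + 1 := ⟨l.length - 1, by omega⟩
    rw [hn] at h2 h4
    simp only [Nat.add_sub_cancel] at h2 h4
    rw [cycSum, hn, Finset.sum_range_succ, Nat.mod_self, h0, h2, h4]
    congr 1
    refine Finset.sum_congr rfl fun i hi => ?_
    rw [Nat.mod_eq_of_lt (by simpa using hi)]

end LabelledPath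

end Cycles


section Growth

variable {T : Triangulation} {M : Type*} [AddCommGroup M]

/-- The labels `m` on the edges in `H` come from the potential `p` up to elements of `N`, and any
two vertices of `H` are joined within `H` by paths realizing every coset element of `N`. -/
structure IsGood (T : Triangulation) (m : ℕ → ℕ → M) (N : AddSubgroup M) (p : ℕ → M)
    (H : Finset (Finset ℕ)) : Prop where
  subset : H ⊆ T.edges
  potential : ∀ u v, ({u, v} : Finset ℕ) ∈ H → m u v + p u + p v ∈ N
  paths : ∀ u v, u ≠ v → (∃ e ∈ H, u ∈ e) → (∃ e ∈ H, v ∈ e) → ∀ k ∈ N,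
    ∃ l, LabelledPath m H u v l (p u + p v + k)

variable {m : ℕ → ℕ → M} {N : AddSubgroup M} {p : ℕ → M} {H : Finset (Finset ℕ)}

theorem IsGood.insert_edge (h : T.IsGood m N p H) (hm : ∀ u v, m u v = m v u) {x z : ℕ}
    (hx : ∃ e ∈ H, x ∈ e) (hz : ∃ e ∈ H, z ∈ e) (he : ({x, z} : Finset ℕ) ∈ T.edges)
    (hp : m x z + p x + p z ∈ N) : T.IsGood m N p (insert {x, z} H) := by
  have hV : ∀ u, (∃ e ∈ insert {x, z} H, u ∈ e) → ∃ e ∈ H, u ∈ e := by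
    rintro u ⟨e, he, hu⟩
    rw [Finset.mem_insert] at he
    rcases he with rfl | he
    · rw [Finset.mem_insert, Finset.mem_singleton] at hu
      rcases hu with rfl | rfl <;> assumption
    · exact ⟨e, he, hu⟩
  refine ⟨Finset.insert_subset he h.subset, ?_, ?_⟩
  · intro u v huv
    rw [Finset.mem_insert] at huv
    rcases huv with huv | huv
    · rcases pair_eq_pair_cases huv with ⟨rfl, rfl⟩ | ⟨rfl, rfl⟩
      · exact hp
      · rw [hm, add_right_comm]
        exact hp
    · exact h.potential u v huv
  · intro u v huv hu hv k hk
    obtain ⟨l, hl⟩ := h.paths u v huv (hV u hu) (hV v hv) k hk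
    exact ⟨l, hl.mono (Finset.subset_insert _ _)⟩

theorem IsGood.insert_vertex (h : T.IsGood m N p H) (h2 : ∀ a : M, a + a = 0)
    (hm : ∀ u v, m u v = m v u)
    (hface : ∀ u v w, T.IsFace u v w → m u v + m v w + m w u = 0) {x y z : ℕ}
    (hxyz : T.IsFace x y z) (hxy : ({x, y} : Finset ℕ) ∈ H) (hz : ¬ ∃ e ∈ H, z ∈ e) :
    T.IsGood m N (Function.update p z (p x + m x z)) (insert {x, z} (insert {y, z} H)) := by
  have hx : ∃ e ∈ H, x ∈ e := ⟨_, hxy, by simp⟩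
  have hy : ∃ e ∈ H, y ∈ e := ⟨_, hxy, by simp⟩
  have hxy' := hxyz.ne
  set q := Function.update p z (p x + m x z) with hq
  have hqz : q z = p x + m x z := by simp [hq]
  have hqv : ∀ v, v ≠ z → q v = p v := fun v hv => by simp [hq, hv]
  have hqV : ∀ v, (∃ e ∈ H, v ∈ e) → q v = p v := fun v hv => hqv v (by rintro rfl; exact hz hv)
  have hsub : H ⊆ insert {x, z} (insert {y, z} H) :=
    (Finset.subset_insert _ _).trans (Finset.subset_insert _ _)
  have hV : ∀ u, u ≠ z → (∃ e ∈ insert {x, z} (insert {y, z} H), u ∈ e) → ∃ e ∈ H, u ∈ e := by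
    rintro u huz ⟨e, he, hu⟩
    simp only [Finset.mem_insert] at he
    rcases he with rfl | rfl | he
    · simp only [Finset.mem_insert, Finset.mem_singleton, huz, or_false] at hu
      exact hu ▸ hx
    · simp only [Finset.mem_insert, Finset.mem_singleton, huz, or_false] at hu
      exact hu ▸ hy
    · exact ⟨e, he, hu⟩
  have hf := hface x y z hxyz
  have hN : m x y + p x + p y ∈ N := h.potential x y hxy
  have hpot : ∀ v, v = x ∨ v = y → m z v + q z + q v ∈ N := by
    rintro v (rfl | rfl)
    · rw [hqz, hqV v hx, hm z v]
      convert N.zero_mem using 1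
      linear_combination (norm := module) h2 (m v z) + h2 (p v)
    · rw [hqz, hqV v hy]
      convert hN using 1
      rw [hm z x, hm v z] at hf
      linear_combination (norm := module) hf - h2 (m x v)
  have hnew : ∀ v, v ≠ z → (∃ e ∈ H, v ∈ e) → ∀ k ∈ N,
      ∃ l, LabelledPath m (insert {x, z} (insert {y, z} H)) z v l (q z + q v + k) := by
    intro v hvz hv k hk
    have main : ∀ b, b = x ∨ b = y → b ≠ v →
        ∃ l, LabelledPath m (insert {x, z} (insert {y, z} H)) z v l (q z + q v + k) := by
      intro b hb hbv
      have hbH : ∃ e ∈ H, b ∈ e := by rcases hb with rfl | rfl <;> assumption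
      obtain ⟨l, hl⟩ := h.paths b v hbv hbH hv (m z b + q z + q b + k)
        (N.add_mem (hpot b hb) hk)
      have hzl : z ∉ l := by
        intro hzl
        rcases hl.mem hzl with h' | h'
        · exact hvz h'.symm
        · exact hz h'
      have hedge : ({z, b} : Finset ℕ) ∈ insert {x, z} (insert {y, z} H) := by
        rw [Finset.pair_comm z b]
        rcases hb with rfl | rfl <;> simp
      refine ⟨z :: l, ?_⟩
      convert LabelledPath.cons hedge hzl (hl.mono hsub) using 1
      rw [hqV b hbH, hqV v hv]
      linear_combination (norm := module) - h2 (m z b) - h2 (p b)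
    by_cases hvx : v = x
    · exact main y (Or.inr rfl) (by rw [hvx]; exact hxy'.symm)
    · exact main x (Or.inl rfl) (Ne.symm hvx)
  refine ⟨?_, ?_, ?_⟩
  · refine Finset.insert_subset (pair_mem_edges.2 ⟨y, hxyz.rot.rot.swap⟩)
      (Finset.insert_subset (pair_mem_edges.2 ⟨x, hxyz.rot⟩) h.subset)
  · intro u v huv
    simp only [Finset.mem_insert] at huv
    rcases huv with huv | huv | huv
    · rcases pair_eq_pair_cases huv with ⟨rfl, rfl⟩ | ⟨rfl, rfl⟩
      · rw [hm, add_right_comm]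
        exact hpot u (Or.inl rfl)
      · exact hpot v (Or.inl rfl)
    · rcases pair_eq_pair_cases huv with ⟨rfl, rfl⟩ | ⟨rfl, rfl⟩
      · rw [hm, add_right_comm]
        exact hpot u (Or.inr rfl)
      · exact hpot v (Or.inr rfl)
    · rw [hqV u ⟨_, huv, by simp⟩, hqV v ⟨_, huv, by simp⟩]
      exact h.potential u v huv
  · intro u v huv hu hv k hk
    by_cases huz : u = z
    · subst huz
      exact hnew v huv.symm (hV v huv.symm hv) k hk
    by_cases hvz : v = z
    · subst hvz
      obtain ⟨l, hl⟩ := hnew u huz (hV u huz hu) k hk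
      exact ⟨_, by rw [add_comm (q u)]; exact hl.reverse hm⟩
    · obtain ⟨l, hl⟩ := h.paths u v huv (hV u huz hu) (hV v hvz hv) k hk
      exact ⟨l, by rw [hqv u huz, hqv v hvz]; exact hl.mono hsub⟩

/-- If the labels `m` are not given by a potential modulo `N`, then some coset of `N` other than
`N` itself consists of labels of cycles. -/
theorem IsGood.potential_or_cycles (h : T.IsGood m N p H) (hH : H.Nonempty)
    (h2 : ∀ a : M, a + a = 0) (hm : ∀ u v, m u v = m v u)
    (hface : ∀ u v w, T.IsFace u v w → m u v + m v w + m w u = 0) :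
    (∃ q : ℕ → M, ∀ u v w, T.IsFace u v w → m u v + q u + q v ∈ N) ∨
      ∃ t ∉ N, ∀ k ∈ N, ∃ c, T.IsCycle c ∧ cycSum m c = t + k := by
  by_contra hcon
  push Not at hcon
  obtain ⟨hcon1, hcon2⟩ := hcon
  obtain ⟨H, hH', hmax⟩ := (T.edges.powerset.filter
    (fun H => H.Nonempty ∧ ∃ p, T.IsGood m N p H)).exists_max_image Finset.card
      ⟨H, Finset.mem_filter.2 ⟨Finset.mem_powerset.2 h.subset, hH, p, h⟩⟩
  obtain ⟨-, hH, p, h⟩ := Finset.mem_filter.1 hH'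
  have hmax' : ∀ q H', T.IsGood m N q H' → H ⊆ H' → H' ⊆ H := by
    intro q H' hq hsub
    exact (Finset.eq_of_subset_of_card_le hsub (hmax H' (Finset.mem_filter.2
      ⟨Finset.mem_powerset.2 hq.subset, hH.mono hsub, q, hq⟩))).ge
  have hclosed : ∀ x y z, T.IsFace x y z → ({x, y} : Finset ℕ) ∈ H → ({x, z} : Finset ℕ) ∈ H := by
    intro x y z hf hxy
    by_contra hxz
    by_cases hz : ∃ e ∈ H, z ∈ e
    · have hx : ∃ e ∈ H, x ∈ e := ⟨_, hxy, by simp⟩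
      have hf' : T.IsFace x z y := hf.rot.rot.swap
      have hxzE : ({x, z} : Finset ℕ) ∈ T.edges := pair_mem_edges.2 ⟨y, hf'⟩
      by_cases hp : m x z + p x + p z ∈ N
      · exact hxz (hmax' p _ (h.insert_edge hm hx hz hxzE hp) (Finset.subset_insert _ _)
          (Finset.mem_insert_self _ _))
      · obtain ⟨k, hk, hno⟩ := hcon2 _ hp
        obtain ⟨l, hl⟩ := h.paths x z hf'.ne hx hz k hk
        obtain ⟨h3, h4⟩ := hl.exists_cycle hf'.ne h.subset (by rwa [Finset.pair_comm]) hxz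
        refine hno l h3 ?_
        rw [h4, hm z x]
        abel
    · exact hxz (hmax' _ _ (h.insert_vertex h2 hm hface hf hxy hz)
        ((Finset.subset_insert _ _).trans (Finset.subset_insert _ _)) (Finset.mem_insert_self _ _))
  obtain ⟨e, he⟩ := hH
  obtain ⟨a, b, c, rfl, hf⟩ := exists_pair_of_mem_edges (h.subset he)
  have hall : ∀ u v w, T.IsFace u v w → ({u, v} : Finset ℕ) ∈ H := by
    have key : ∀ g ∈ T.faces, ∀ u v w, g = {u, v, w} → ({u, v} : Finset ℕ) ∈ H := by
      intro g hg
      have closure : ∀ u v w, T.IsFace u v w → ({u, v} : Finset ℕ) ∈ H →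
          ∀ x y z, ({u, v, w} : Finset ℕ) = {x, y, z} → ({x, y} : Finset ℕ) ∈ H := by
        intro u v w hf huv x y z he
        have h3 := hclosed u v w hf huv
        have h4 := hclosed v u w hf.swap (by rwa [Finset.pair_comm])
        have hxy : x ≠ y := by
          have : T.IsFace x y z := by unfold IsFace; rwa [← he]
          exact this.ne
        have hx : x ∈ ({u, v, w} : Finset ℕ) := by rw [he]; simp
        have hy : y ∈ ({u, v, w} : Finset ℕ) := by rw [he]; simp
        simp only [Finset.mem_insert, Finset.mem_singleton] at hx hy
        have huv' := huv
        have h3' := h3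
        have h4' := h4
        rw [Finset.pair_comm] at huv' h3' h4'
        rcases hx with rfl | rfl | rfl <;> rcases hy with rfl | rfl | rfl <;>
          first | assumption | exact absurd rfl hxy
      refine face_induction (P := fun g => ∀ u v w, g = {u, v, w} → ({u, v} : Finset ℕ) ∈ H) hf
        (fun u v w => closure a b c hf he u v w) ?_ hg
      intro u v w w' _ hf' _ hP
      exact closure u v w' hf' (hP u v w rfl)
    intro u v w huvw
    exact key _ huvw u v w rfl
  obtain ⟨u, v, w, huvw, hno⟩ := hcon1 p
  exact hno (h.potential u v (hall u v w huvw))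

theorem eq_zero_or_eq_of_mem_zmultiples {a k : M} (h2 : ∀ a : M, a + a = 0)
    (hk : k ∈ AddSubgroup.zmultiples a) : k = 0 ∨ k = a := by
  obtain ⟨z, rfl⟩ := AddSubgroup.mem_zmultiples_iff.1 hk
  rcases Int.even_or_odd' z with ⟨y, rfl | rfl⟩
  · left
    rw [mul_comm, mul_smul, two_smul, h2, smul_zero]
  · right
    rw [add_smul, one_smul, mul_comm, mul_smul, two_smul, h2, smul_zero, zero_add]

/-- The edges of a cycle satisfy `IsGood` modulo the label of the cycle. -/
theorem IsCycle.isGood {c : List ℕ} (hc : T.IsCycle c) (h2 : ∀ a : M, a + a = 0)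
    (hm : ∀ u v, m u v = m v u) :
    ∃ p, T.IsGood m (AddSubgroup.zmultiples (cycSum m c)) p (cycEdges c) := by
  obtain ⟨hlen, hnd, hE⟩ := hc
  obtain ⟨n, hn⟩ : ∃ n, c.length = n + 1 := ⟨c.length - 1, by omega⟩
  set P : ℕ → M := fun i => ∑ j ∈ Finset.range i, m (c.getD j 0) (c.getD (j + 1) 0) with hP
  have hPs : ∀ i, P (i + 1) = P i + m (c.getD i 0) (c.getD (i + 1) 0) := fun i =>
    Finset.sum_range_succ _ _
  have hP0 : P 0 = 0 := rfl
  have hsum : cycSum m c = P n + m (c.getD n 0) (c.getD 0 0) := by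
    rw [cycSum, hn, Finset.sum_range_succ, Nat.mod_self]
    congr 1
    refine Finset.sum_congr rfl fun i hi => ?_
    rw [Nat.mod_eq_of_lt (by simpa using hi)]
  set a := cycSum m c with ha
  have hidx : ∀ i < c.length, c.idxOf (c.getD i 0) = i := by
    intro i hi
    rw [List.getD_eq_getElem _ _ hi]
    exact hnd.idxOf_getElem i hi
  have hedge : ∀ i, i + 1 < c.length → ({c.getD i 0, c.getD (i + 1) 0} : Finset ℕ) ∈ cycEdges c := by
    intro i hi
    have := pair_mem_cycEdges (c := c) (i := i) (by omega)
    rwa [Nat.mod_eq_of_lt hi] at this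
  have hforward : ∀ i j, i ≤ j → j < c.length → ∃ l,
      LabelledPath m (cycEdges c) (c.getD i 0) (c.getD j 0) l (P i + P j) ∧
        ∀ x ∈ l, ∃ k, i ≤ k ∧ k ≤ j ∧ x = c.getD k 0 := by
    intro i j hij hj
    induction j, hij using Nat.le_induction with
    | base =>
      exact ⟨_, by rw [h2]; exact .single _, fun x hx => ⟨i, le_rfl, le_rfl, by simpa using hx⟩⟩
    | succ j hij ih =>
      obtain ⟨l, hl, hl'⟩ := ih (by omega)
      refine ⟨l ++ [c.getD (j + 1) 0], ?_, ?_⟩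
      · convert hl.append (.single (c.getD (j + 1) 0)) (hedge j hj) ?_ using 1
        · rw [hPs]
          abel
        · intro x hx hx'
          obtain ⟨k, hk1, hk2, rfl⟩ := hl' x hx
          have := getD_inj hnd (by omega) hj (List.mem_singleton.1 hx')
          omega
      · intro x hx
        rcases List.mem_append.1 hx with hx | hx
        · obtain ⟨k, hk1, hk2, rfl⟩ := hl' x hx
          exact ⟨k, hk1, by omega, rfl⟩
        · exact ⟨j + 1, by omega, le_rfl, List.mem_singleton.1 hx⟩
  have hlast : ({c.getD 0 0, c.getD n 0} : Finset ℕ) ∈ cycEdges c := by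
    have := pair_mem_cycEdges (c := c) (i := n) (by omega)
    rwa [hn, Nat.mod_self, Finset.pair_comm] at this
  have hbackward : ∀ i j, i < j → j < c.length → ∃ l,
      LabelledPath m (cycEdges c) (c.getD i 0) (c.getD j 0) l (P i + P j + a) := by
    intro i j hij hj
    obtain ⟨l, hl, hl'⟩ := hforward 0 i (by omega) (by omega)
    obtain ⟨r, hr, hr'⟩ := hforward j n (by omega) (by omega)
    refine ⟨l.reverse ++ r.reverse, ?_⟩
    · convert (hl.reverse hm).append (hr.reverse hm) hlast ?_ using 1
      · rw [hP0, hsum, hm (c.getD n 0)]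
        abel
      · intro x hx hx'
        obtain ⟨k, hk1, hk2, rfl⟩ := hl' x (List.mem_reverse.1 hx)
        obtain ⟨k', hk3, hk4, h5⟩ := hr' _ (List.mem_reverse.1 hx')
        have := getD_inj hnd (by omega) (by omega) h5
        omega
  have hpath : ∀ i j, i < j → j < c.length → ∀ k ∈ AddSubgroup.zmultiples a, ∃ l,
      LabelledPath m (cycEdges c) (c.getD i 0) (c.getD j 0) l (P i + P j + k) := by
    intro i j hij hj k hk
    rcases eq_zero_or_eq_of_mem_zmultiples h2 hk with rfl | rfl
    · obtain ⟨l, hl, -⟩ := hforward i j hij.le hj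
      exact ⟨l, by rwa [add_zero]⟩
    · exact hbackward i j hij hj
  have hmem : ∀ u, (∃ e ∈ cycEdges c, u ∈ e) → ∃ i < c.length, c.getD i 0 = u := by
    rintro u ⟨e, he, hu⟩
    exact mem_list_iff_getD.1 (mem_of_mem_cycEdges he hu)
  have hpot : ∀ i < c.length, m (c.getD i 0) (c.getD ((i + 1) % c.length) 0) + P i +
      P ((i + 1) % c.length) ∈ AddSubgroup.zmultiples a := by
    intro i hi
    rcases succ_mod_cases hi with ⟨h3, h4⟩ | ⟨h3, h4⟩
    · rw [h4, hPs]
      convert AddSubgroup.zero_mem _ using 1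
      linear_combination (norm := module) h2 (P i) + h2 (m (c.getD i 0) (c.getD (i + 1) 0))
    · obtain rfl : i = n := by omega
      rw [h4, hP0, add_zero, add_comm, ← hsum]
      exact AddSubgroup.mem_zmultiples a
  refine ⟨fun v => P (c.idxOf v), hE, ?_, ?_⟩
  · intro u v huv
    obtain ⟨i, hi, he⟩ := mem_cycEdges.1 huv
    have := hpot i hi
    rcases pair_eq_pair_cases he with ⟨rfl, rfl⟩ | ⟨rfl, rfl⟩
    · rwa [hidx i hi, hidx _ (Nat.mod_lt _ (by omega))]
    · rwa [hidx i hi, hidx _ (Nat.mod_lt _ (by omega)), hm, add_right_comm]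
  · intro u v huv hu hv k hk
    obtain ⟨i, hi, rfl⟩ := hmem u hu
    obtain ⟨j, hj, rfl⟩ := hmem v hv
    rw [hidx i hi, hidx j hj]
    rcases lt_trichotomy i j with hij | rfl | hij
    · exact hpath i j hij hj k hk
    · exact absurd rfl huv
    · obtain ⟨l, hl⟩ := hpath j i hij hi k hk
      exact ⟨_, by rw [add_comm (P i)]; exact hl.reverse hm⟩

end Growth


section LocalSign

variable {T : Triangulation} {u v w a b c d x : ℕ}

/-- The third vertex of the other face at the edge `uv` of the face `uvw`. -/
noncomputable def opposite (T : Triangulation) (u v w : ℕ) : ℕ :=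
  if h : ∃ x, x ≠ w ∧ T.IsFace u v x then h.choose else w

theorem IsFace.opposite_ne (h : T.IsFace u v w) : T.opposite u v w ≠ w := by
  rw [opposite, dif_pos h.exists_opposite]
  exact h.exists_opposite.choose_spec.1

theorem IsFace.opposite (h : T.IsFace u v w) : T.IsFace u v (T.opposite u v w) := by
  rw [Triangulation.opposite, dif_pos h.exists_opposite]
  exact h.exists_opposite.choose_spec.2

theorem IsFace.opposite_eq (h : T.IsFace u v w) (h' : T.IsFace u v x) (hx : x ≠ w) :
    T.opposite u v w = x :=
  (h.eq_or_eq h' hx.symm h.opposite).resolve_left h.opposite_ne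

theorem IsFace.opposite_opposite (h : T.IsFace u v w) :
    T.opposite u v (T.opposite u v w) = w :=
  h.opposite.opposite_eq h h.opposite_ne.symm

theorem IsFace.flip (h : T.IsFace v a b) : T.IsFace v b a := h.rot.rot.swap

/-- The oriented link edges at the vertex `v`. -/
abbrev Link (T : Triangulation) (v : ℕ) : Type := {x : ℕ × ℕ // T.IsFace v x.1 x.2}

instance (T : Triangulation) (v : ℕ) : Finite (T.Link v) :=
  Finite.of_injective
    (fun x : T.Link v => ((⟨x.1.1, x.2.rot.mem_verts⟩, ⟨x.1.2, x.2.rot.rot.mem_verts⟩) :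
      T.verts × T.verts)) (by
      rintro ⟨⟨a, b⟩, h⟩ ⟨⟨c, d⟩, h'⟩ he
      simpa using he)

/-- The rotation of the oriented link edges around the vertex `v`. -/
noncomputable def rotation (T : Triangulation) (v : ℕ) : Equiv.Perm (T.Link v) where
  toFun x := ⟨(x.1.2, T.opposite v x.1.2 x.1.1), x.2.flip.opposite⟩
  invFun x := ⟨(T.opposite v x.1.1 x.1.2, x.1.1), x.2.opposite.flip⟩
  left_inv := by
    rintro ⟨⟨a, b⟩, h⟩
    simp only [h.flip.opposite_opposite]
  right_inv := by
    rintro ⟨⟨a, b⟩, h⟩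
    simp only [h.opposite_opposite]

/-- The reversal of oriented link edges. -/
def reversal (x : T.Link v) : T.Link v := ⟨(x.1.2, x.1.1), x.2.flip⟩

theorem reversal_ne (x : T.Link v) : reversal x ≠ x := by
  rcases x with ⟨⟨a, b⟩, h⟩
  intro he
  simp only [reversal, Subtype.mk.injEq, Prod.mk.injEq] at he
  exact h.rot.ne he.2

theorem rotation_eq (h : T.IsFace v a b) (h' : T.IsFace v b c) (hac : a ≠ c) :
    T.rotation v ⟨(a, b), h⟩ = ⟨(b, c), h'⟩ := by
  simp [rotation, h.flip.opposite_eq h' hac.symm]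

theorem rotation_reversal (x : T.Link v) :
    T.rotation v (reversal (T.rotation v x)) = reversal x := by
  rcases x with ⟨⟨a, b⟩, h⟩
  exact rotation_eq h.flip.opposite.flip h.flip h.flip.opposite_ne

theorem rotation_pow_reversal (n : ℕ) (x : T.Link v) :
    (T.rotation v ^ n) (reversal ((T.rotation v ^ n) x)) = reversal x := by
  induction n with
  | zero => rfl
  | succ n ih =>
    rw [pow_succ, Equiv.Perm.mul_apply, ← pow_succ, pow_succ', Equiv.Perm.mul_apply,
      rotation_reversal, ih]

theorem not_sameCycle_reversal (x : T.Link v) :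
    ¬ (T.rotation v).SameCycle x (reversal x) := by
  intro h
  obtain ⟨n, hn⟩ := h.exists_nat_pow_eq
  rcases Nat.even_or_odd' n with ⟨k, rfl | rfl⟩
  · rw [two_mul, pow_add, Equiv.Perm.mul_apply] at hn
    have := (T.rotation v ^ k).injective (hn.trans (rotation_pow_reversal k x).symm)
    exact reversal_ne _ this.symm
  · rw [two_mul, add_assoc, pow_add, Equiv.Perm.mul_apply] at hn
    have h1 := (T.rotation v ^ k).injective (hn.trans (rotation_pow_reversal k x).symm)
    rw [pow_succ', Equiv.Perm.mul_apply] at h1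
    generalize (T.rotation v ^ k) x = y at h1
    rcases y with ⟨⟨a, b⟩, hy⟩
    simp only [rotation, reversal, Equiv.coe_fn_mk, Subtype.mk.injEq, Prod.mk.injEq] at h1
    exact hy.flip.opposite_ne h1.2

theorem sameCycle_or_reversal (x y : T.Link v) :
    (T.rotation v).SameCycle x y ∨ (T.rotation v).SameCycle x (reversal y) := by
  rcases x with ⟨⟨a, b⟩, h⟩
  rcases y with ⟨⟨c, d⟩, h'⟩
  refine link_induction (P := fun c d => ∀ h' : T.IsFace v c d,
    (T.rotation v).SameCycle ⟨(a, b), h⟩ ⟨(c, d), h'⟩ ∨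
      (T.rotation v).SameCycle ⟨(a, b), h⟩ ⟨(d, c), h'.flip⟩) h ?_ ?_ ?_ h' h'
  · exact fun _ => Or.inl (Equiv.Perm.SameCycle.refl _ _)
  · exact fun x y hf hP hf' => (hP hf).symm
  · intro x y z hf1 hf2 hyz hP hf2'
    rcases hP hf1 with hP | hP
    · right
      rwa [← Equiv.Perm.sameCycle_apply_right, rotation_eq hf2.flip hf1 hyz.symm]
    · left
      rwa [← rotation_eq hf1.flip hf2 hyz, Equiv.Perm.sameCycle_apply_right]

/-- `s v a b` records whether the face `vab`, oriented from `a` to `b` around `v`, agrees with a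
fixed orientation of the star of `v`. -/
structure IsLocalSign (T : Triangulation) (s : ℕ → ℕ → ℕ → ZMod 2) : Prop where
  flip : ∀ {v a b}, T.IsFace v a b → s v b a = s v a b + 1
  next : ∀ {v a b c}, T.IsFace v a b → T.IsFace v b c → a ≠ c → s v b c = s v a b
  reach : ∀ {v a b c d} (h : T.IsFace v a b) (h' : T.IsFace v c d), s v a b = s v c d →
    ∃ n : ℕ, (T.rotation v ^ n) ⟨(a, b), h⟩ = ⟨(c, d), h'⟩

theorem exists_isLocalSign (T : Triangulation) : ∃ s, T.IsLocalSign s := by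
  have key : ∀ v, ∃ s : ℕ → ℕ → ZMod 2, (∀ {a b}, T.IsFace v a b → s b a = s a b + 1) ∧
      (∀ {a b c}, T.IsFace v a b → T.IsFace v b c → a ≠ c → s b c = s a b) ∧
      (∀ {a b c d} (h : T.IsFace v a b) (h' : T.IsFace v c d), s a b = s c d →
        ∃ n : ℕ, (T.rotation v ^ n) ⟨(a, b), h⟩ = ⟨(c, d), h'⟩) := by
    intro v
    by_cases hv : Nonempty (T.Link v)
    · obtain ⟨x₀⟩ := hv
      set s : ℕ → ℕ → ZMod 2 := fun a b =>
        if ∃ h : T.IsFace v a b, (T.rotation v).SameCycle x₀ ⟨(a, b), h⟩ then 0 else 1 with hs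
      have h0 : ∀ {a b} (h : T.IsFace v a b),
          s a b = 0 ↔ (T.rotation v).SameCycle x₀ ⟨(a, b), h⟩ := by
        intro a b h
        by_cases hc : (T.rotation v).SameCycle x₀ ⟨(a, b), h⟩
        · simp [hs, h, hc]
        · simp [hs, h, hc]
      have hflip : ∀ {a b}, T.IsFace v a b → s b a = s a b + 1 := by
        intro a b h
        have h1 := not_sameCycle_reversal (⟨(a, b), h⟩ : T.Link v)
        have h2 := sameCycle_or_reversal x₀ ⟨(a, b), h⟩
        have h3 := h0 h
        have h4 := h0 h.flip
        have h5 : ¬ (s a b = 0 ∧ s b a = 0) := fun ⟨h6, h7⟩ =>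
          h1 ((h3.1 h6).symm.trans (h4.1 h7))
        have h6 : s a b = 0 ∨ s b a = 0 := h2.imp h3.2 h4.2
        have : ∀ p q : ZMod 2, ¬ (p = 0 ∧ q = 0) → (p = 0 ∨ q = 0) → q = p + 1 := by decide
        exact this _ _ h5 h6
      refine ⟨s, hflip, ?_, ?_⟩
      · intro a b c h h' hac
        have h1 := h0 h
        have h2 := h0 h'
        rw [← rotation_eq h h' hac, Equiv.Perm.sameCycle_apply_right, ← h1] at h2
        have : ∀ p q : ZMod 2, (p = 0 ↔ q = 0) → p = q := by decide
        exact this _ _ h2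
      · intro a b c d h h' he
        refine Equiv.Perm.SameCycle.exists_nat_pow_eq ?_
        rcases sameCycle_or_reversal (⟨(a, b), h⟩ : T.Link v) ⟨(c, d), h'⟩ with h1 | h1
        · exact h1
        · exfalso
          have h2 := h0 h
          have h3 := h0 h'.flip
          have h4 : s a b = s d c := by
            have : ∀ p q : ZMod 2, (p = 0 ↔ q = 0) → p = q := by decide
            refine this _ _ (h2.trans (Iff.trans ?_ h3.symm))
            exact ⟨fun h => h.trans h1, fun h => h.trans h1.symm⟩
          rw [hflip h', he] at h4
          simp at h4
    · exact ⟨fun _ _ => 0, fun h => (hv ⟨⟨(_, _), h⟩⟩).elim, fun h => (hv ⟨⟨(_, _), h⟩⟩).elim,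
        fun h => (hv ⟨⟨(_, _), h⟩⟩).elim⟩
  choose s hs using key
  exact ⟨s, fun h => (hs _).1 h, fun h => (hs _).2.1 h, fun h => (hs _).2.2 h⟩

namespace IsLocalSign

variable {s : ℕ → ℕ → ℕ → ZMod 2}

theorem ne_third (hs : T.IsLocalSign s) (h : T.IsFace v a b) (h' : T.IsFace v a c) (hbc : b ≠ c) :
    s v a c = s v a b + 1 := by
  rw [hs.next h.flip h' hbc, hs.flip h]

theorem third_unique (hs : T.IsLocalSign s) (h : T.IsFace v a b) (h' : T.IsFace v a c)
    (he : s v a b = s v a c) : b = c := by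
  by_contra hbc
  rw [hs.ne_third h h' hbc] at he
  simp at he

theorem exists_third (hs : T.IsLocalSign s) (h : T.IsFace v a b) (ε : ZMod 2) :
    ∃ c, T.IsFace v a c ∧ s v a c = ε := by
  obtain ⟨c, hc, h'⟩ := h.exists_opposite
  have h1 := hs.ne_third h h' hc.symm
  have : ∀ p q ε : ZMod 2, q = p + 1 → p = ε ∨ q = ε := by decide
  rcases this _ _ ε h1 with h2 | h2
  exacts [⟨b, h, h2⟩, ⟨c, h', h2⟩]

end IsLocalSign

/-- The sign of the edge `uv` comparing the orientations of the stars of `u` and `v`. -/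
noncomputable def edgeSign (T : Triangulation) (s : ℕ → ℕ → ℕ → ZMod 2) (u v : ℕ) : ZMod 2 :=
  if h : ∃ w, T.IsFace u v w then s u v h.choose + s v h.choose u else 0

variable {s : ℕ → ℕ → ℕ → ZMod 2}

theorem IsLocalSign.edgeSign_eq (hs : T.IsLocalSign s) (h : T.IsFace u v w) :
    T.edgeSign s u v = s u v w + s v w u := by
  have h' : ∃ w, T.IsFace u v w := ⟨w, h⟩
  rw [edgeSign, dif_pos h']
  have hx := h'.choose_spec
  generalize h'.choose = x at hx
  by_cases hwx : x = w
  · rw [hwx]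
  · have h1 := hs.ne_third h hx (Ne.symm hwx)
    have h2 := hs.ne_third h.swap hx.swap (Ne.symm hwx)
    rw [hs.flip hx.rot, hs.flip h.rot] at h2
    have : ∀ a b c d : ZMod 2, a = b + 1 → c + 1 = d + 1 + 1 → a + c = b + d := by decide
    exact this _ _ _ _ h1 h2

theorem IsLocalSign.edgeSign_comm (hs : T.IsLocalSign s) (u v : ℕ) :
    T.edgeSign s u v = T.edgeSign s v u := by
  by_cases h : ∃ w, T.IsFace u v w
  · obtain ⟨w, h⟩ := h
    rw [hs.edgeSign_eq h, hs.edgeSign_eq h.swap, hs.flip h.rot, hs.flip h]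
    have : ∀ a b : ZMod 2, a + b = b + 1 + (a + 1) := by decide
    exact this _ _
  · have h' : ¬ ∃ w, T.IsFace v u w := fun ⟨w, hw⟩ => h ⟨w, hw.swap⟩
    rw [edgeSign, edgeSign, dif_neg h, dif_neg h']

theorem IsLocalSign.edgeSign_face (hs : T.IsLocalSign s) (h : T.IsFace u v w) :
    T.edgeSign s u v + T.edgeSign s v w + T.edgeSign s w u = 0 := by
  rw [hs.edgeSign_eq h, hs.edgeSign_eq h.rot, hs.edgeSign_eq h.rot.rot]
  have : ∀ a b c : ZMod 2, a + b + (b + c) + (c + a) = 0 := by decide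
  exact this _ _ _

end LocalSign

section OneSidedness

variable {T : Triangulation} {c : List ℕ} {s : ℕ → ℕ → ℕ → ZMod 2}

theorem cornerRel_of_isFace {i a b d : ℕ} (hi : i < c.length) (h : T.IsFace (c.getD i 0) a b)
    (h' : T.IsFace (c.getD i 0) a d) (hbd : b ≠ d)
    (he : ({c.getD i 0, a} : Finset ℕ) ∉ cycEdges c) :
    T.CornerRel c (i, {c.getD i 0, a, b}) (i, {c.getD i 0, a, d}) := by
  refine ⟨⟨hi, h, by simp⟩, ⟨hi, h', by simp⟩, Or.inl ⟨rfl, ?_⟩⟩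
  simp only [h.inter_eq hbd]
  exact ⟨Finset.card_pair h.ne, by simp, he⟩

theorem cornerRel_succ {i w : ℕ} (hi : i < c.length)
    (h : T.IsFace (c.getD i 0) (c.getD ((i + 1) % c.length) 0) w) :
    T.CornerRel c (i, {c.getD i 0, c.getD ((i + 1) % c.length) 0, w})
      ((i + 1) % c.length, {c.getD i 0, c.getD ((i + 1) % c.length) 0, w}) := by
  refine ⟨⟨hi, h, by simp⟩, ⟨Nat.mod_lt _ (by omega), h, by simp⟩, Or.inr ⟨rfl, rfl, ?_⟩⟩
  intro x
  simp only [Finset.mem_insert, Finset.mem_singleton]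
  tauto

/-- The corners of the sector at a cycle vertex between two consecutive cycle edges are
equivalent. -/
theorem IsLocalSign.eqvGen_sector (hs : T.IsLocalSign s) {i u u' w x : ℕ}
    (hi : i < c.length)
    (hcyc : ∀ b, ({c.getD i 0, b} : Finset ℕ) ∈ cycEdges c → b = u ∨ b = u')
    (h : T.IsFace (c.getD i 0) u' x) (h' : T.IsFace (c.getD i 0) w u)
    (he : s (c.getD i 0) u' x = s (c.getD i 0) w u) :
    Relation.EqvGen (T.CornerRel c) (i, {c.getD i 0, u', x}) (i, {c.getD i 0, w, u}) := by
  set v := c.getD i 0 with hv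
  have hreach := hs.reach h h' he
  set n := Nat.find hreach with hn
  have hn' := Nat.find_spec hreach
  rw [← hn] at hn'
  have key : ∀ j ≤ n, ∃ a b, ∃ hf : T.IsFace v a b,
      (T.rotation v ^ j) ⟨(u', x), h⟩ = ⟨(a, b), hf⟩ ∧ s v a b = s v u' x ∧
      Relation.EqvGen (T.CornerRel c) (i, {v, u', x}) (i, {v, a, b}) := by
    intro j
    induction j with
    | zero => exact fun _ => ⟨u', x, h, rfl, rfl, .refl _⟩
    | succ j ih =>
      intro hj
      obtain ⟨a, b, hf, h1, h2, h3⟩ := ih (by omega)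
      have hf' := hf.flip.opposite
      have hne := hf.flip.opposite_ne
      have hrot := rotation_eq hf hf' hne.symm
      have hnext := hs.next hf hf' hne.symm
      set d := T.opposite v b a
      have h4 : (T.rotation v ^ (j + 1)) ⟨(u', x), h⟩ = ⟨(b, d), hf'⟩ := by
        rw [pow_succ', Equiv.Perm.mul_apply, h1, hrot]
      refine ⟨b, d, hf', h4, by rw [hnext, h2], h3.trans _ _ _ (.rel _ _ ?_)⟩
      rw [show ({v, a, b} : Finset ℕ) = {v, b, a} by rw [Finset.pair_comm]]
      refine cornerRel_of_isFace hi hf.flip hf' hne.symm fun hb => ?_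
      rcases hcyc b hb with rfl | rfl
      · have : a = w := by
          refine hs.third_unique hf.flip h'.flip ?_
          rw [hs.flip hf, hs.flip h', h2, he]
        subst this
        exact Nat.find_min hreach (by omega : j < n) h1
      · have : d = x := hs.third_unique hf' h (by rw [hnext, h2])
        subst this
        refine Nat.find_min hreach (by omega : n - (j + 1) < n) ?_
        rw [show n = n - (j + 1) + (j + 1) by omega, pow_add, Equiv.Perm.mul_apply, h4] at hn'
        exact hn'
  obtain ⟨a, b, hf, h1, -, h3⟩ := key n le_rfl
  have : (⟨(a, b), hf⟩ : T.Link v) = ⟨(w, u), h'⟩ := by rw [← h1, hn']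
  simp only [Subtype.mk.injEq, Prod.mk.injEq] at this
  obtain ⟨rfl, rfl⟩ := this
  exact h3

theorem IsCycle.exists_isFace (hc : T.IsCycle c) {i : ℕ} (hi : i < c.length) :
    ∃ w, T.IsFace (c.getD i 0) (c.getD ((i + 1) % c.length) 0) w :=
  pair_mem_edges.1 (hc.2.2 _ (pair_mem_cycEdges hi))

/-- A cycle along which the orientations of vertex stars reverse is one-sided. -/
theorem IsLocalSign.oneSided (hs : T.IsLocalSign s) (hc : T.IsCycle c)
    (hodd : cycSum (T.edgeSign s) c = 1) : T.OneSided c := by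
  obtain ⟨hlen, hnd, -⟩ := id hc
  set n := c.length with hn
  set C : ℕ → ℕ := fun i => c.getD i 0 with hC
  have hpos : 0 < n := by omega
  set X : ℕ → ℕ → ℕ × Finset ℕ := fun i w => (i, {C i, C ((i + 1) % n), w}) with hX
  have hstep : ∀ i < n, ∀ w w', T.IsFace (C i) (C ((i + 1) % n)) w →
      T.IsFace (C ((i + 1) % n)) (C (((i + 1) % n + 1) % n)) w' →
      s (C ((i + 1) % n)) (C (((i + 1) % n + 1) % n)) w' =
        s (C i) (C ((i + 1) % n)) w + T.edgeSign s (C i) (C ((i + 1) % n)) →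
      Relation.EqvGen (T.CornerRel c) (X i w) (X ((i + 1) % n) w') := by
    intro i hi w w' h h' he
    refine .trans _ _ _ (.rel _ _ (cornerRel_succ hi h)) (.symm _ _ ?_)
    have hj : (i + 1) % n < n := Nat.mod_lt _ hpos
    have := hs.eqvGen_sector hj (u := C i) (u' := C (((i + 1) % n + 1) % n)) (w := w) (x := w')
      ?_ h' h.rot ?_
    · convert this using 2
      ext y
      simp only [Finset.mem_insert, Finset.mem_singleton]
      tauto
    · intro b hb
      rcases eq_of_pair_mem_cycEdges hnd hj hb with h1 | ⟨k, hk, h1, rfl⟩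
      · exact Or.inr h1
      · left
        have : k = i := by
          rcases succ_mod_cases hk with h2 | h2 <;> rcases succ_mod_cases hi with h3 | h3 <;> omega
        rw [this]
    · rw [hs.edgeSign_eq h] at he
      have key : ∀ a b d : ZMod 2, a = b + (b + d) → a = d := by decide
      exact key _ _ _ he
  set S : ℕ → ZMod 2 := fun i =>
    ∑ j ∈ Finset.range i, T.edgeSign s (C j) (C ((j + 1) % n)) with hS
  have hchain : ∀ w, T.IsFace (C 0) (C (1 % n)) w → ∀ i < n, ∀ w',
      T.IsFace (C i) (C ((i + 1) % n)) w' →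
      s (C i) (C ((i + 1) % n)) w' = s (C 0) (C (1 % n)) w + S i →
      Relation.EqvGen (T.CornerRel c) (X 0 w) (X i w') := by
    intro w hw i
    induction i with
    | zero =>
      intro _ w' hw' he
      rw [show S 0 = 0 from rfl, add_zero] at he
      rw [hs.third_unique hw' hw he]
      exact .refl _
    | succ i ih =>
      intro hi w' hw' he
      obtain ⟨w₀, hw₀⟩ := hc.exists_isFace (show i < n by omega)
      obtain ⟨w₁, hw₁, he₁⟩ := hs.exists_third hw₀ (s (C 0) (C (1 % n)) w + S i)
      refine (ih (by omega) w₁ hw₁ he₁).trans _ _ _ ?_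
      have := hstep i (by omega) w₁ w' hw₁
      rw [Nat.mod_eq_of_lt hi] at this he₁
      refine this hw' ?_
      rw [he, he₁, add_assoc, hS]
      simp only [Finset.sum_range_succ, Nat.mod_eq_of_lt hi]
  obtain ⟨w₀, hw₀⟩ := hc.exists_isFace (i := 0) hpos
  rw [zero_add] at hw₀
  have hloop : ∀ w, T.IsFace (C 0) (C (1 % n)) w →
      Relation.EqvGen (T.CornerRel c) (X 0 w₀) (X 0 w) := by
    intro w hw
    by_cases hww : w₀ = w
    · rw [hww]
      exact .refl _
    have hsgn := hs.ne_third hw₀ hw hww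
    obtain ⟨k, hk⟩ : ∃ k, k + 1 = n := ⟨n - 1, by omega⟩
    have hkn : (k + 1) % n = 0 := by rw [hk, Nat.mod_self]
    obtain ⟨w₁, hw₁⟩ := hc.exists_isFace (show k < n by omega)
    obtain ⟨w₂, hw₂, he₂⟩ := hs.exists_third hw₁ (s (C 0) (C (1 % n)) w₀ + S k)
    refine (hchain w₀ hw₀ k (by omega) w₂ hw₂ he₂).trans _ _ _ ?_
    have hodd' : S k + T.edgeSign s (C k) (C ((k + 1) % n)) = 1 := by
      rw [← hodd, cycSum, ← hn, ← Finset.sum_range_succ, hk]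
    have := hstep k (by omega) w₂ w hw₂
    rw [← hn] at he₂
    rw [hkn, zero_add] at this
    rw [hkn] at hodd' he₂
    refine this hw ?_
    refine hsgn.trans ?_
    rw [he₂, add_assoc, hodd']
  have hedge : ∀ i < n, ∀ w, T.IsFace (C i) (C ((i + 1) % n)) w →
      Relation.EqvGen (T.CornerRel c) (X 0 w₀) (X i w) := by
    intro i hi w hw
    obtain ⟨w₁, hw₁, he₁⟩ := hs.exists_third hw₀ (s (C i) (C ((i + 1) % n)) w - S i)
    exact (hloop w₁ hw₁).trans _ _ _ (hchain w₁ hw₁ i hi w hw (by rw [he₁]; abel))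
  have hedge' : ∀ i < n, ∀ b d, T.IsFace (C i) b d → ({C i, b} : Finset ℕ) ∈ cycEdges c →
      Relation.EqvGen (T.CornerRel c) (X 0 w₀) (i, {C i, b, d}) := by
    intro i hi b d hf hb
    rcases eq_of_pair_mem_cycEdges hnd hi hb with rfl | ⟨j, hj, rfl, rfl⟩
    · exact hedge i hi d hf
    · refine (hedge j hj d hf.swap).trans _ _ _ (.rel _ _ ?_)
      have := cornerRel_succ hj hf.swap
      convert this using 2
      rw [Finset.insert_comm]
  have hall : ∀ x, T.IsCorner c x → Relation.EqvGen (T.CornerRel c) (X 0 w₀) x := by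
    rintro ⟨i, f⟩ ⟨hi, hf, hmem⟩
    change i < n at hi
    change f ∈ T.faces at hf
    change C i ∈ f at hmem
    obtain ⟨a, b, rfl, hab⟩ := exists_isFace_of_mem hf hmem
    obtain ⟨w, hw⟩ := hc.exists_isFace hi
    have key : ∀ k : ℕ, ∀ a b, ∀ hab : T.IsFace (C i) a b,
        (T.rotation (C i) ^ k) ⟨(_, _), hw⟩ = ⟨(a, b), hab⟩ →
        Relation.EqvGen (T.CornerRel c) (X 0 w₀) (i, {C i, a, b}) := by
      intro k
      induction k with
      | zero =>
        intro a b hab he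
        simp only [pow_zero, Equiv.Perm.coe_one, id_eq] at he
        obtain ⟨rfl, rfl⟩ := he
        exact hedge i hi _ hw
      | succ k ih =>
        intro b d hbd he
        rw [pow_succ', Equiv.Perm.mul_apply] at he
        obtain ⟨⟨⟨a, b'⟩, hab⟩, hy⟩ : ∃ y, (T.rotation (C i) ^ k) ⟨(_, _), hw⟩ = y := ⟨_, rfl⟩
        have h1 := ih a b' hab hy
        rw [hy, rotation_eq hab hab.flip.opposite hab.flip.opposite_ne.symm] at he
        simp only [Subtype.mk.injEq, Prod.mk.injEq] at he
        obtain ⟨rfl, hd⟩ := he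
        have hne := hab.flip.opposite_ne
        rw [hd] at hne
        by_cases hcyc : ({C i, b'} : Finset ℕ) ∈ cycEdges c
        · exact hedge' i hi _ _ hbd hcyc
        · refine h1.trans _ _ _ (.rel _ _ ?_)
          rw [show ({C i, a, b'} : Finset ℕ) = {C i, b', a} by rw [Finset.pair_comm]]
          exact cornerRel_of_isFace hi hab.flip hbd hne.symm hcyc
    by_cases hsg : s (C i) (C ((i + 1) % n)) w = s (C i) a b
    · obtain ⟨k, hk⟩ := hs.reach hw hab hsg
      exact key k a b hab hk
    · obtain ⟨k, hk⟩ := hs.reach hw hab.flip (by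
        rw [hs.flip hab]
        have : ∀ p q : ZMod 2, p ≠ q → p = q + 1 := by decide
        exact this _ _ hsg)
      have := key k b a hab.flip hk
      rwa [Finset.pair_comm b a] at this
  exact fun x y hx hy => (hall x hx).symm.trans _ _ _ (hall y hy)

end OneSidedness


section OrientationSign

variable {T : Triangulation} {E : Finset (Finset ℕ)} {s : ℕ → ℕ → ℕ → ZMod 2} {u v w w' : ℕ}

/-- `s u v w` records whether the cyclic order `uvw` of a face agrees with an orientation of the
faces that is coherent across all edges outside `E`. -/
structure IsOrientationSign (T : Triangulation) (E : Finset (Finset ℕ))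
    (s : ℕ → ℕ → ℕ → ZMod 2) : Prop where
  rot : ∀ {u v w}, T.IsFace u v w → s v w u = s u v w
  swap : ∀ {u v w}, T.IsFace u v w → s v u w = s u v w + 1
  cross : ∀ {u v w w'}, T.IsFace u v w → T.IsFace u v w' → w ≠ w' →
    ({u, v} : Finset ℕ) ∉ E → s u v w' = s u v w + 1

theorem mem_dedges {p q a b d : ℕ} : (p, q) ∈ dedges (a, b, d) ↔
    (p = a ∧ q = b) ∨ (p = b ∧ q = d) ∨ (p = d ∧ q = a) := by
  simp [dedges]

theorem mem_dedges_rot {x y z : ℕ} (h : T.IsFace u v w)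
    (he : ({x, y, z} : Finset ℕ) = {u, v, w}) :
    ((v, w) ∈ dedges (x, y, z) ↔ (u, v) ∈ dedges (x, y, z)) ∧
      ((v, u) ∈ dedges (x, y, z) ↔ (u, v) ∉ dedges (x, y, z)) := by
  have h1 := h.ne
  have h2 := h.rot.ne
  have h3 := h.rot.rot.ne
  have hu : u ∈ ({x, y, z} : Finset ℕ) := by rw [he]; simp
  have hv : v ∈ ({x, y, z} : Finset ℕ) := by rw [he]; simp
  have hw : w ∈ ({x, y, z} : Finset ℕ) := by rw [he]; simp
  simp only [Finset.mem_insert, Finset.mem_singleton] at hu hv hw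
  rw [mem_dedges, mem_dedges, mem_dedges]
  grind

theorem exists_isOrientationSign {σ : Finset ℕ → ℕ × ℕ × ℕ}
    (h1 : ∀ f ∈ T.faces, ({(σ f).1, (σ f).2.1, (σ f).2.2} : Finset ℕ) = f)
    (h2 : ∀ f ∈ T.faces, ∀ g ∈ T.faces, f ≠ g → f ∩ g ∉ E →
      Disjoint (dedges (σ f)) (dedges (σ g))) : ∃ s, T.IsOrientationSign E s := by
  set s : ℕ → ℕ → ℕ → ZMod 2 := fun u v w => if (u, v) ∈ dedges (σ {u, v, w}) then 0 else 1 with hs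
  have hrot : ∀ {u v w}, T.IsFace u v w → s v w u = s u v w := by
    intro u v w h
    have he : ({v, w, u} : Finset ℕ) = {u, v, w} := by ext; simp; tauto
    simp only [hs, he, (mem_dedges_rot h (h1 _ h)).1]
  have hswap : ∀ {u v w}, T.IsFace u v w → s v u w = s u v w + 1 := by
    intro u v w h
    have he : ({v, u, w} : Finset ℕ) = {u, v, w} := by ext; simp; tauto
    simp only [hs, he, (mem_dedges_rot h (h1 _ h)).2]
    by_cases h : (u, v) ∈ dedges (σ {u, v, w}) <;> simp [h]
    decide
  have hzero : ∀ {u v w}, s u v w = 0 ↔ (u, v) ∈ dedges (σ {u, v, w}) := by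
    intro u v w
    by_cases h : (u, v) ∈ dedges (σ {u, v, w}) <;> simp [hs, h]
  have hne : ∀ {u v w w'}, T.IsFace u v w → T.IsFace u v w' → w ≠ w' →
      ({u, v} : Finset ℕ) ∉ E → ¬ (s u v w = 0 ∧ s u v w' = 0) := by
    rintro u v w w' h h' hw hE ⟨h3, h4⟩
    have := h2 _ h _ h' (fun he => hw (h.third_eq_of_eq he)) (by rwa [h.inter_eq hw])
    exact Finset.disjoint_left.1 this (hzero.1 h3) (hzero.1 h4)
  refine ⟨s, hrot, hswap, ?_⟩
  intro u v w w' h h' hw hE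
  have h3 := hne h h' hw hE
  have h4 := hne h.swap h'.swap hw (by rwa [Finset.pair_comm])
  rw [hswap h, hswap h'] at h4
  have : ∀ p q : ZMod 2, ¬ (p = 0 ∧ q = 0) → ¬ (p + 1 = 0 ∧ q + 1 = 0) → q = p + 1 := by decide
  exact this _ _ h3 h4

theorem IsOrientationSign.exists_coherent (hs : T.IsOrientationSign E s) :
    ∃ σ : Finset ℕ → ℕ × ℕ × ℕ,
      (∀ f ∈ T.faces, ({(σ f).1, (σ f).2.1, (σ f).2.2} : Finset ℕ) = f) ∧
      ∀ f ∈ T.faces, ∀ g ∈ T.faces, f ≠ g → f ∩ g ∉ E →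
        Disjoint (dedges (σ f)) (dedges (σ g)) := by
  have key : ∀ f : Finset ℕ, ∃ t : ℕ × ℕ × ℕ, f ∈ T.faces →
      ({t.1, t.2.1, t.2.2} : Finset ℕ) = f ∧ s t.1 t.2.1 t.2.2 = 0 := by
    intro f
    by_cases hf : f ∈ T.faces
    · obtain ⟨u, v, w, rfl, h⟩ := exists_isFace hf
      have h1 := hs.swap h
      have : ∀ p q : ZMod 2, q = p + 1 → p = 0 ∨ q = 0 := by decide
      rcases this _ _ h1 with h2 | h2
      · exact ⟨(u, v, w), fun _ => ⟨rfl, h2⟩⟩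
      · exact ⟨(v, u, w), fun _ => ⟨Finset.insert_comm _ _ _, h2⟩⟩
    · exact ⟨(0, 0, 0), fun h => absurd h hf⟩
  choose σ hσ using key
  have hmem : ∀ f ∈ T.faces, ∀ p q, (p, q) ∈ dedges (σ f) →
      ∃ w, f = {p, q, w} ∧ T.IsFace p q w ∧ s p q w = 0 := by
    intro f hf p q hpq
    obtain ⟨h1, h2⟩ := hσ f hf
    rcases hσf : σ f with ⟨a, b, d⟩
    rw [hσf] at h1 h2 hpq
    simp only at h1 h2
    have hface : T.IsFace a b d := by rwa [← h1] at hf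
    rcases mem_dedges.1 hpq with ⟨rfl, rfl⟩ | ⟨rfl, rfl⟩ | ⟨rfl, rfl⟩
    · exact ⟨d, h1.symm, hface, h2⟩
    · exact ⟨a, by rw [← h1]; ext; simp; tauto, hface.rot, by rw [hs.rot hface, h2]⟩
    · exact ⟨b, by rw [← h1]; ext; simp; tauto, hface.rot.rot,
        by rw [hs.rot hface.rot, hs.rot hface, h2]⟩
  refine ⟨σ, fun f hf => (hσ f hf).1, ?_⟩
  intro f hf g hg hfg hE
  rw [Finset.disjoint_left]
  rintro ⟨p, q⟩ hp hq
  obtain ⟨w, rfl, h, h0⟩ := hmem f hf p q hp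
  obtain ⟨w', rfl, h', h0'⟩ := hmem g hg p q hq
  have hw : w ≠ w' := by
    rintro rfl
    exact hfg rfl
  rw [h.inter_eq hw] at hE
  have := hs.cross h h' hw hE
  rw [h0, h0'] at this
  exact absurd this (by decide)

theorem IsOrientationSign.orientable (hs : T.IsOrientationSign ∅ s) : T.Orientable := by
  obtain ⟨σ, h1, h2⟩ := hs.exists_coherent
  exact ⟨σ, h1, fun f hf g hg hfg => h2 f hf g hg hfg (by simp)⟩

end OrientationSign

section Flags

variable {T : Triangulation} {c : List ℕ} {E : Finset (Finset ℕ)} {s : ℕ → ℕ → ℕ → ZMod 2}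
  {u v w w' : ℕ}

/-- The positively oriented flags of the faces of `T`. -/
noncomputable def flags (T : Triangulation) (s : ℕ → ℕ → ℕ → ZMod 2) : Finset (ℕ × ℕ × ℕ) :=
  (T.verts ×ˢ T.verts ×ˢ T.verts).filter fun x =>
    T.IsFace x.1 x.2.1 x.2.2 ∧ s x.1 x.2.1 x.2.2 = 0

theorem mem_flags : (u, v, w) ∈ T.flags s ↔ T.IsFace u v w ∧ s u v w = 0 := by
  simp only [flags, Finset.mem_filter, Finset.mem_product, and_iff_right_iff_imp]
  exact fun h => ⟨h.1.mem_verts, h.1.rot.mem_verts, h.1.rot.rot.mem_verts⟩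

theorem IsOrientationSign.card_flags_edges (hs : T.IsOrientationSign E s)
    {E' : Finset (Finset ℕ)} (hE' : E' ⊆ T.edges) :
    ((T.flags s).filter fun x => ({x.1, x.2.1} : Finset ℕ) ∈ E').card = 2 * E'.card := by
  rw [Finset.card_eq_sum_card_fiberwise (f := fun x : ℕ × ℕ × ℕ => ({x.1, x.2.1} : Finset ℕ))
    (s := (T.flags s).filter fun x => ({x.1, x.2.1} : Finset ℕ) ∈ E') (t := E') (fun x hx => (Finset.mem_filter.1 hx).2)]
  rw [Finset.sum_const_nat (m := 2), mul_comm]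
  intro e he
  obtain ⟨u, v, w, rfl, h⟩ := exists_pair_of_mem_edges (hE' he)
  obtain ⟨w', hw, h'⟩ := h.exists_opposite
  have key : ∀ {w}, T.IsFace u v w → ∃ x ∈ T.flags s, ({x.1, x.2.1} : Finset ℕ) = {u, v} ∧
      x.2.2 = w ∧ ∀ y ∈ T.flags s, ({y.1, y.2.1} : Finset ℕ) = {u, v} → y.2.2 = w → y = x := by
    intro w h
    have h1 := hs.swap h
    have : ∀ p q : ZMod 2, q = p + 1 → p = 0 ∧ q ≠ 0 ∨ q = 0 ∧ p ≠ 0 := by decide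
    rcases this _ _ h1 with h2 | h2
    · refine ⟨(u, v, w), mem_flags.2 ⟨h, h2.1⟩, rfl, rfl, ?_⟩
      rintro ⟨a, b, d⟩ hy h3 rfl
      rcases pair_eq_pair_cases h3 with ⟨rfl, rfl⟩ | ⟨rfl, rfl⟩
      · rfl
      · exact absurd (mem_flags.1 hy).2 h2.2
    · refine ⟨(v, u, w), mem_flags.2 ⟨h.swap, h2.1⟩, Finset.pair_comm _ _, rfl, ?_⟩
      rintro ⟨a, b, d⟩ hy h3 rfl
      rcases pair_eq_pair_cases h3 with ⟨rfl, rfl⟩ | ⟨rfl, rfl⟩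
      · exact absurd (mem_flags.1 hy).2 h2.2
      · rfl
  obtain ⟨x, hx, hx1, hx2, hx3⟩ := key h
  obtain ⟨y, hy, hy1, hy2, hy3⟩ := key h'
  have hxy : x ≠ y := by
    rintro rfl
    exact hw (hy2.symm.trans hx2)
  rw [Finset.card_eq_two]
  refine ⟨x, y, hxy, ?_⟩
  ext z
  simp only [Finset.mem_filter, Finset.mem_insert, Finset.mem_singleton]
  constructor
  · rintro ⟨⟨hz, -⟩, hz1⟩
    rcases z with ⟨a, b, d⟩
    have hd : T.IsFace u v d := by
      rcases pair_eq_pair_cases hz1 with ⟨rfl, rfl⟩ | ⟨rfl, rfl⟩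
      exacts [(mem_flags.1 hz).1, (mem_flags.1 hz).1.swap]
    rcases h.eq_or_eq h' hw.symm hd with h1 | h1
    exacts [Or.inl (hx3 _ hz hz1 h1), Or.inr (hy3 _ hz hz1 h1)]
  · rintro (rfl | rfl)
    · exact ⟨⟨hx, by rwa [hx1]⟩, hx1⟩
    · exact ⟨⟨hy, by rwa [hy1]⟩, hy1⟩

theorem IsOrientationSign.card_flags (hs : T.IsOrientationSign E s) :
    (T.flags s).card = 2 * T.edges.card := by
  rw [← hs.card_flags_edges subset_rfl, Finset.filter_true_of_mem]
  rintro ⟨u, v, w⟩ hx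
  exact pair_mem_edges.2 ⟨w, (mem_flags.1 hx).1⟩

theorem IsOrientationSign.card_flags_faces (hs : T.IsOrientationSign E s) :
    (T.flags s).card = 3 * T.faces.card := by
  rw [Finset.card_eq_sum_card_fiberwise (s := T.flags s)
    (f := fun x : ℕ × ℕ × ℕ => ({x.1, x.2.1, x.2.2} : Finset ℕ)) (t := T.faces) (fun x hx => (mem_flags.1 hx).1)]
  rw [Finset.sum_const_nat (m := 3), mul_comm]
  have key : ∀ u v w, T.IsFace u v w → s u v w = 0 →
      ((T.flags s).filter fun x => ({x.1, x.2.1, x.2.2} : Finset ℕ) = {u, v, w}).card = 3 := by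
    intro u v w h h0
    have h1 := h.ne
    have h2 := h.rot.ne
    have h3 := h.rot.rot.ne
    have hr1 := hs.rot h
    have hr2 := hs.rot h.rot
    have hs1 := hs.swap h
    have hs2 := hs.swap h.rot
    have hs3 := hs.swap h.rot.rot
    rw [Finset.card_eq_three]
    refine ⟨(u, v, w), (v, w, u), (w, u, v), by simp [h1], by simp [h3.symm], by simp [h2], ?_⟩
    ext ⟨a, b, d⟩
    simp only [Finset.mem_filter, Finset.mem_insert, Finset.mem_singleton, Prod.mk.injEq]
    constructor
    · rintro ⟨hm, he⟩
      rw [mem_flags] at hm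
      have h4 := hm.1.ne
      have h5 := hm.1.rot.ne
      have h6 := hm.1.rot.rot.ne
      have ha : a ∈ ({u, v, w} : Finset ℕ) := by rw [← he]; simp
      have hb : b ∈ ({u, v, w} : Finset ℕ) := by rw [← he]; simp
      have hd : d ∈ ({u, v, w} : Finset ℕ) := by rw [← he]; simp
      simp only [Finset.mem_insert, Finset.mem_singleton] at ha hb hd
      have h7 := hm.2
      have : (0 : ZMod 2) + 1 ≠ 0 := by decide
      rcases ha with rfl | rfl | rfl <;> rcases hb with rfl | rfl | rfl <;>
        rcases hd with rfl | rfl | rfl <;> simp_all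
    · rintro (⟨rfl, rfl, rfl⟩ | ⟨rfl, rfl, rfl⟩ | ⟨rfl, rfl, rfl⟩)
      · exact ⟨mem_flags.2 ⟨h, h0⟩, rfl⟩
      · exact ⟨mem_flags.2 ⟨h.rot, by rw [hr1, h0]⟩, by ext; simp; tauto⟩
      · exact ⟨mem_flags.2 ⟨h.rot.rot, by rw [hr2, hr1, h0]⟩, by ext; simp; tauto⟩
  intro f hf
  obtain ⟨u, v, w, rfl, h⟩ := exists_isFace hf
  have : ∀ p q : ZMod 2, q = p + 1 → p = 0 ∨ q = 0 := by decide
  rcases this _ _ (hs.swap h) with h2 | h2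
  · exact key u v w h h2
  · rw [← key v u w h.swap h2]
    rw [Finset.insert_comm]

end Flags


section FlagPerm

variable {T : Triangulation} {c : List ℕ} {E : Finset (Finset ℕ)} {s : ℕ → ℕ → ℕ → ZMod 2}
  {u v w w' : ℕ}

theorem card_image_univ_eq {α β γ : Type*} [Fintype α] [DecidableEq β] [DecidableEq γ] {f : α → β} {g : α → γ}
    (h : ∀ x y, f x = f y ↔ g x = g y) :
    (Finset.univ.image f).card = (Finset.univ.image g).card := by
  have h1 : ∀ b ∈ Finset.univ.image f, ∃ x, f x = b := by
    intro b hb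
    simpa using hb
  choose k hk using h1
  refine Finset.card_bij (fun b hb => g (k b hb)) ?_ ?_ ?_
  · intro b hb
    exact Finset.mem_image_of_mem _ (Finset.mem_univ _)
  · intro b hb b' hb' he
    rw [← h, hk, hk] at he
    exact he
  · intro d hd
    obtain ⟨x, -, rfl⟩ := Finset.mem_image.1 hd
    exact ⟨f x, Finset.mem_image_of_mem _ (Finset.mem_univ _), (h _ _).1 (hk _ _)⟩

/-- A fixed-point-free permutation on `n` letters whose orbits are the fibres of `f` has sign
`(-1) ^ (n + k)`, where `k` is the number of values of `f`. -/
theorem sign_eq_of_fibers {α β : Type*} [Fintype α] [DecidableEq α] [DecidableEq β]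
    {r : Equiv.Perm α} (hr : ∀ x, r x ≠ x)
    {f : α → β} (hf : ∀ x y, f x = f y ↔ r.SameCycle x y) :
    Equiv.Perm.sign r = (-1) ^ (Fintype.card α + (Finset.univ.image f).card) := by
  have hsupp : r.support = Finset.univ := by
    ext x
    simp [hr x]
  have h1 : r.cycleFactorsFinset = Finset.univ.image r.cycleOf := by
    ext τ
    rw [Finset.mem_image]
    constructor
    · intro hτ
      have hτc := (Equiv.Perm.mem_cycleFactorsFinset_iff.1 hτ).1
      obtain ⟨x, hx⟩ := hτc.nonempty_support
      exact ⟨x, Finset.mem_univ _, (Equiv.Perm.cycle_is_cycleOf hx hτ).symm⟩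
    · rintro ⟨x, -, rfl⟩
      rw [Equiv.Perm.cycleOf_mem_cycleFactorsFinset_iff, hsupp]
      exact Finset.mem_univ _
  rw [Equiv.Perm.sign_of_cycleType, Equiv.Perm.sum_cycleType, hsupp, Finset.card_univ,
    Equiv.Perm.cycleType_def, Multiset.card_map, Finset.card_val, h1]
  rw [card_image_univ_eq (f := f) (g := r.cycleOf) fun x y => by
    rw [hf, Equiv.Perm.sameCycle_iff_cycleOf_eq_of_mem_support] <;> simp [hsupp]]

namespace IsOrientationSign

/-- The cyclic shift of positive flags. -/
noncomputable def shift (hs : T.IsOrientationSign E s) : Equiv.Perm (T.flags s) where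
  toFun x := ⟨(x.1.2.1, x.1.2.2, x.1.1),
    have h := mem_flags.1 x.2
    mem_flags.2 ⟨h.1.rot, by rw [hs.rot h.1, h.2]⟩⟩
  invFun x := ⟨(x.1.2.2, x.1.1, x.1.2.1),
    have h := mem_flags.1 x.2
    mem_flags.2 ⟨h.1.rot.rot, by rw [hs.rot h.1.rot, hs.rot h.1, h.2]⟩⟩
  left_inv _ := rfl
  right_inv _ := rfl

theorem cross_mem_flags (hs : T.IsOrientationSign E s) (h : (u, v, w) ∈ T.flags s)
    (hE : ({u, v} : Finset ℕ) ∉ E) (h' : T.IsFace u v w') (hw : w ≠ w') :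
    (v, u, w') ∈ T.flags s := by
  obtain ⟨h1, h2⟩ := mem_flags.1 h
  refine mem_flags.2 ⟨h'.swap, ?_⟩
  rw [hs.swap h', hs.cross h1 h' hw hE, h2]
  decide

/-- The exchange of the positive flags at an edge outside `E`. -/
noncomputable def crossFun (hs : T.IsOrientationSign E s) (x : T.flags s) : T.flags s :=
  if h : ({x.1.1, x.1.2.1} : Finset ℕ) ∈ E then x
  else ⟨(x.1.2.1, x.1.1, T.opposite x.1.1 x.1.2.1 x.1.2.2),
    have hf := (mem_flags.1 x.2).1
    hs.cross_mem_flags x.2 h hf.opposite hf.opposite_ne.symm⟩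

theorem crossFun_of_mem (hs : T.IsOrientationSign E s) {x : T.flags s}
    (h : ({x.1.1, x.1.2.1} : Finset ℕ) ∈ E) : hs.crossFun x = x := dif_pos h

theorem crossFun_eq (hs : T.IsOrientationSign E s) (h : (u, v, w) ∈ T.flags s)
    (hE : ({u, v} : Finset ℕ) ∉ E) (h' : T.IsFace u v w') (hw : w ≠ w') :
    hs.crossFun ⟨(u, v, w), h⟩ = ⟨(v, u, w'), hs.cross_mem_flags h hE h' hw⟩ := by
  rw [crossFun, dif_neg hE]
  simp only [(mem_flags.1 h).1.opposite_eq h' hw.symm]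

theorem exists_crossFun_eq (hs : T.IsOrientationSign E s) (h : (u, v, w) ∈ T.flags s)
    (hE : ({u, v} : Finset ℕ) ∉ E) : ∃ w', w ≠ w' ∧ ∃ h' : (v, u, w') ∈ T.flags s,
      T.IsFace u v w' ∧ hs.crossFun ⟨(u, v, w), h⟩ = ⟨(v, u, w'), h'⟩ := by
  obtain ⟨w', hw, h'⟩ := (mem_flags.1 h).1.exists_opposite
  exact ⟨w', hw.symm, _, h', hs.crossFun_eq h hE h' hw.symm⟩

theorem crossFun_involutive (hs : T.IsOrientationSign E s) :
    Function.Involutive hs.crossFun := by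
  rintro ⟨⟨u, v, w⟩, h⟩
  by_cases hE : ({u, v} : Finset ℕ) ∈ E
  · have h1 : hs.crossFun ⟨(u, v, w), h⟩ = ⟨(u, v, w), h⟩ := hs.crossFun_of_mem hE
    rw [h1, h1]
  · obtain ⟨w', hw, h', -, he⟩ := hs.exists_crossFun_eq h hE
    rw [he]
    exact hs.crossFun_eq h' (by rwa [Finset.pair_comm]) (mem_flags.1 h).1.swap hw.symm

theorem crossFun_eq_self_iff (hs : T.IsOrientationSign E s) (x : T.flags s) :
    hs.crossFun x = x ↔ ({x.1.1, x.1.2.1} : Finset ℕ) ∈ E := by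
  refine ⟨?_, hs.crossFun_of_mem⟩
  obtain ⟨⟨u, v, w⟩, h⟩ := x
  intro he
  by_contra hE
  obtain ⟨w', -, h', -, he'⟩ := hs.exists_crossFun_eq h hE
  rw [he'] at he
  simp only [Subtype.mk.injEq, Prod.mk.injEq] at he
  exact (mem_flags.1 h).1.ne he.2.1

/-- The rotation of positive flags around the vertices of the surface cut along `E`, closed up
along the boundary. -/
noncomputable def flagPerm (hs : T.IsOrientationSign E s) : Equiv.Perm (T.flags s) :=
  hs.crossFun_involutive.toPerm * hs.shift⁻¹

theorem flagPerm_apply (hs : T.IsOrientationSign E s) (h : (u, v, w) ∈ T.flags s)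
    (h' : (w, u, v) ∈ T.flags s) :
    hs.flagPerm ⟨(u, v, w), h⟩ = hs.crossFun ⟨(w, u, v), h'⟩ := rfl

theorem rot_mem_flags (hs : T.IsOrientationSign E s) (h : (u, v, w) ∈ T.flags s) :
    (w, u, v) ∈ T.flags s := (hs.shift⁻¹ ⟨(u, v, w), h⟩).2

theorem sign_flagPerm (hs : T.IsOrientationSign E s) (hE : E ⊆ T.edges) :
    Equiv.Perm.sign hs.flagPerm = (-1) ^ (T.edges.card - E.card) := by
  have h1 : Equiv.Perm.sign hs.shift⁻¹ = 1 := by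
    have h3 : hs.shift⁻¹ ^ 3 = 1 := by
      ext x : 1
      rfl
    have h4 : Equiv.Perm.sign hs.shift⁻¹ ^ 3 = 1 := by rw [← map_pow, h3, map_one]
    rcases Int.units_eq_one_or (Equiv.Perm.sign hs.shift⁻¹) with h5 | h5
    · exact h5
    · rw [h5] at h4
      exact absurd h4 (by decide)
  have h2 : Fintype.card (Function.fixedPoints hs.crossFun_involutive.toPerm) = 2 * E.card := by
    rw [← hs.card_flags_edges hE, ← Fintype.card_coe]
    refine Fintype.card_congr ⟨fun x => ⟨x.1.1, ?_⟩, fun x => ⟨⟨x.1, ?_⟩, ?_⟩, ?_, ?_⟩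
    · exact Finset.mem_filter.2 ⟨x.1.2, (hs.crossFun_eq_self_iff x.1).1 x.2⟩
    · exact (Finset.mem_filter.1 x.2).1
    · exact (hs.crossFun_eq_self_iff _).2 (Finset.mem_filter.1 x.2).2
    · exact fun _ => rfl
    · exact fun _ => rfl
  have h3 : hs.crossFun_involutive.toPerm ^ 2 = 1 := by
    ext x : 1
    exact hs.crossFun_involutive x
  rw [flagPerm, map_mul, h1, mul_one, Equiv.Perm.sign_of_pow_two_eq_one h3, h2,
    Fintype.card_coe, hs.card_flags]
  congr 1
  omega

theorem flagPerm_ne (hs : T.IsOrientationSign E s) (x : T.flags s) : hs.flagPerm x ≠ x := by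
  obtain ⟨⟨u, v, w⟩, h⟩ := x
  have h' := hs.rot_mem_flags h
  have hf := (mem_flags.1 h).1
  rw [hs.flagPerm_apply h h']
  by_cases hE : ({w, u} : Finset ℕ) ∈ E
  · rw [hs.crossFun_of_mem hE]
    intro he
    simp only [Subtype.mk.injEq, Prod.mk.injEq] at he
    exact hf.ne he.2.1
  · obtain ⟨w', -, h1, -, he⟩ := hs.exists_crossFun_eq h' hE
    rw [he]
    intro he
    simp only [Subtype.mk.injEq, Prod.mk.injEq] at he
    exact hf.rot.ne he.2.1.symm

/-- The vertices of the face of a flag. -/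
abbrev flagFace (x : ℕ × ℕ × ℕ) : Finset ℕ := {x.1, x.2.1, x.2.2}

theorem flip (hs : T.IsOrientationSign E s) (h : T.IsFace u v w) : s u w v = s u v w + 1 := by
  rw [hs.rot h.swap, hs.swap h]

theorem exists_flag (hs : T.IsOrientationSign E s) {f : Finset ℕ} (hf : f ∈ T.faces)
    (hv : v ∈ f) : ∃ p : T.flags s, p.1.1 = v ∧ flagFace p.1 = f := by
  obtain ⟨a, b, rfl, h⟩ := exists_isFace_of_mem hf hv
  have : ∀ p q : ZMod 2, q = p + 1 → p = 0 ∨ q = 0 := by decide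
  rcases this _ _ (hs.flip h) with h2 | h2
  · exact ⟨⟨(v, a, b), mem_flags.2 ⟨h, h2⟩⟩, rfl, rfl⟩
  · exact ⟨⟨(v, b, a), mem_flags.2 ⟨h.flip, h2⟩⟩, rfl, by rw [flagFace, Finset.pair_comm]⟩

theorem flag_ext (hs : T.IsOrientationSign E s) {p q : T.flags s} (hpq : p.1.1 = q.1.1)
    (hf : flagFace p.1 = flagFace q.1) : p = q := by
  obtain ⟨⟨v, a, b⟩, hp⟩ := p
  obtain ⟨⟨v', a', b'⟩, hq⟩ := q
  obtain rfl : v = v' := hpq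
  change ({v, a, b} : Finset ℕ) = {v, a', b'} at hf
  obtain ⟨h1, h2⟩ := mem_flags.1 hp
  obtain ⟨h3, h4⟩ := mem_flags.1 hq
  have ha : a ∈ ({v, a', b'} : Finset ℕ) := by rw [← hf]; simp
  simp only [Finset.mem_insert, Finset.mem_singleton] at ha
  rcases ha with rfl | rfl | rfl
  · exact absurd rfl h1.ne
  · obtain rfl := h1.third_eq_of_eq hf
    rfl
  · rw [Finset.pair_comm a' a] at hf
    obtain rfl := h1.third_eq_of_eq hf
    rw [hs.flip h1, h2] at h4
    exact absurd h4 (by decide)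

theorem sameCycle_of_cross (hs : T.IsOrientationSign E s) {p q : T.flags s} {f g : Finset ℕ}
    (hp : p.1.1 = v) (hpf : flagFace p.1 = f) (hq : q.1.1 = v) (hqg : flagFace q.1 = g)
    (hfg : (f ∩ g).card = 2) (hE : f ∩ g ∉ E) : hs.flagPerm.SameCycle p q := by
  have key : ∀ {x w w' : ℕ} {p q : T.flags s}, p.1.1 = v → flagFace p.1 = {v, x, w} →
      q.1.1 = v → flagFace q.1 = {v, x, w'} → T.IsFace v x w → T.IsFace v x w' → w ≠ w' →
      ({v, x} : Finset ℕ) ∉ E → s v x w = 0 → hs.flagPerm.SameCycle p q := by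
    intro x w w' p q hp hpf hq hqg h h' hw hE h0
    have hp' : (v, x, w) ∈ T.flags s := mem_flags.2 ⟨h, h0⟩
    have hq1 : (x, v, w') ∈ T.flags s := hs.cross_mem_flags hp' hE h' hw
    have hq' : (v, w', x) ∈ T.flags s := (hs.shift ⟨(x, v, w'), hq1⟩).2
    obtain rfl : p = ⟨(v, x, w), hp'⟩ := hs.flag_ext hp hpf
    obtain rfl : q = ⟨(v, w', x), hq'⟩ := hs.flag_ext hq (by rw [hqg, Finset.pair_comm])
    have : hs.flagPerm ⟨(v, w', x), hq'⟩ = ⟨(v, x, w), hp'⟩ :=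
      (hs.flagPerm_apply hq' hq1).trans
        (hs.crossFun_eq hq1 (by rwa [Finset.pair_comm]) h.swap hw.symm)
    rw [← this, Equiv.Perm.sameCycle_apply_left]
  have hfT : f ∈ T.faces := by rw [← hpf]; exact (mem_flags.1 p.2).1
  have hgT : g ∈ T.faces := by rw [← hqg]; exact (mem_flags.1 q.2).1
  obtain ⟨x, w, w', rfl, rfl, h, h', hw, he⟩ := exists_of_card_inter_of_mem (u := v) hfT hgT hfg
    (by rw [← hpf, ← hp]; simp) (by rw [← hqg, ← hq]; simp)
  rw [he] at hE
  have : ∀ p q : ZMod 2, q = p + 1 → p = 0 ∨ q = 0 := by decide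
  rcases this _ _ (hs.cross h h' hw hE) with h0 | h0
  · exact key hp hpf hq hqg h h' hw hE h0
  · exact (key hq hqg hp hpf h' h hw.symm hE h0).symm

theorem sameCycle_of_boundary (hs : T.IsOrientationSign E s) {p q : T.flags s}
    (hpq : flagFace p.1 = flagFace q.1) (hE : ({p.1.1, q.1.1} : Finset ℕ) ∈ E)
    (hne : p.1.1 ≠ q.1.1) : hs.flagPerm.SameCycle p q := by
  obtain ⟨⟨v, a, b⟩, hp⟩ := p
  have hq : q.1.1 ∈ ({v, a, b} : Finset ℕ) := by
    change q.1.1 ∈ flagFace (v, a, b)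
    rw [hpq]
    simp
  simp only [Finset.mem_insert, Finset.mem_singleton] at hq
  have h1 := hs.rot_mem_flags hp
  have h2 := hs.rot_mem_flags h1
  rcases hq with h | h | h
  · exact absurd h.symm hne
  · obtain rfl : q = ⟨(a, b, v), h2⟩ := hs.flag_ext h
      (by rw [← hpq, flagFace, flagFace]; ext; simp; tauto)
    have : hs.flagPerm ⟨(a, b, v), h2⟩ = ⟨(v, a, b), hp⟩ := hs.crossFun_of_mem hE
    rw [← this, Equiv.Perm.sameCycle_apply_left]
  · obtain rfl : q = ⟨(b, v, a), h1⟩ := hs.flag_ext h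
      (by rw [← hpq, flagFace, flagFace]; ext; simp; tauto)
    have : hs.flagPerm ⟨(v, a, b), hp⟩ = ⟨(b, v, a), h1⟩ :=
      hs.crossFun_of_mem (x := ⟨(b, v, a), h1⟩) (by rwa [Finset.pair_comm] at hE)
    rw [← this, Equiv.Perm.sameCycle_apply_right]

/-- A flag at the vertex `v` of the face `f`. -/
noncomputable def flagAt (x₀ : T.flags s) (v : ℕ) (f : Finset ℕ) : T.flags s :=
  if h : ∃ p : T.flags s, p.1.1 = v ∧ flagFace p.1 = f then h.choose else x₀

theorem flagAt_spec (hs : T.IsOrientationSign E s) (x₀ : T.flags s) {f : Finset ℕ}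
    (hf : f ∈ T.faces) (hv : v ∈ f) :
    (flagAt x₀ v f).1.1 = v ∧ flagFace (flagAt x₀ v f).1 = f := by
  rw [flagAt, dif_pos (hs.exists_flag hf hv)]
  exact (hs.exists_flag hf hv).choose_spec

theorem eq_flagAt (hs : T.IsOrientationSign E s) (x₀ p : T.flags s) :
    p = flagAt x₀ p.1.1 (flagFace p.1) := by
  have := hs.flagAt_spec x₀ (mem_flags.1 p.2).1 (v := p.1.1) (by simp)
  exact hs.flag_ext this.1.symm this.2.symm

theorem sameCycle_of_not_mem (hs : T.IsOrientationSign E s) {p q : T.flags s}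
    (hpq : p.1.1 = q.1.1) (hE : ∀ e ∈ E, p.1.1 ∉ e) : hs.flagPerm.SameCycle p q := by
  set v := p.1.1 with hv
  have hp : flagFace p.1 ∈ T.faces := (mem_flags.1 p.2).1
  have hq : flagFace q.1 ∈ T.faces := (mem_flags.1 q.2).1
  have key : hs.flagPerm.SameCycle (flagAt p v (flagFace p.1)) (flagAt p v (flagFace q.1)) := by
    have h0 := T.link_connected v _ hp _ hq (by simp [hv]) (by simp [hpq])
    generalize flagFace q.1 = g at h0
    induction h0 with
    | refl => exact .refl _ _
    | tail _ h ih =>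
      obtain ⟨h1, h2, h3, h4, h5⟩ := h
      have s1 := hs.flagAt_spec p h1 h3
      have s2 := hs.flagAt_spec p h2 h4
      refine ih.trans (hs.sameCycle_of_cross s1.1 s1.2 s2.1 s2.2 h5 fun h6 => ?_)
      exact hE _ h6 (Finset.mem_inter.2 ⟨h3, h4⟩)
  rw [← hs.eq_flagAt p p, hpq, ← hs.eq_flagAt] at key
  exact key

theorem sameCycle_of_oneSided (hs : T.IsOrientationSign (cycEdges c) s) (hc : T.IsCycle c)
    (h1 : T.OneSided c) {p q : T.flags s} (hp : p.1.1 ∈ c) (hq : q.1.1 ∈ c) :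
    hs.flagPerm.SameCycle p q := by
  obtain ⟨i, hi, hip⟩ := mem_list_iff_getD.1 hp
  obtain ⟨j, hj, hjq⟩ := mem_list_iff_getD.1 hq
  have key : ∀ x y : ℕ × Finset ℕ, Relation.EqvGen (T.CornerRel c) x y →
      hs.flagPerm.SameCycle (flagAt p (c.getD x.1 0) x.2) (flagAt p (c.getD y.1 0) y.2) := by
    intro x y hxy
    induction hxy with
    | rel x y h =>
      obtain ⟨⟨hx1, hx2, hx3⟩, ⟨hy1, hy2, hy3⟩, h⟩ := h
      have s1 := hs.flagAt_spec p hx2 hx3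
      have s2 := hs.flagAt_spec p hy2 hy3
      rcases h with ⟨h1, h2, -, h3⟩ | ⟨h1, h2, -⟩
      · exact hs.sameCycle_of_cross s1.1 s1.2 (s2.1.trans (by rw [h1])) s2.2 h2 h3
      · refine hs.sameCycle_of_boundary (by rw [s1.2, s2.2, h2]) ?_ ?_
        · rw [s1.1, s2.1, h1]
          exact pair_mem_cycEdges hx1
        · rw [s1.1, s2.1]
          intro he
          have h3 := getD_inj hc.2.1 hx1 hy1 he
          have h4 := hc.1
          rcases succ_mod_cases hx1 with h5 | h5 <;> omega
    | refl x => exact .refl _ _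
    | symm x y _ ih => exact ih.symm
    | trans x y z _ _ ih1 ih2 => exact ih1.trans ih2
  have := key (i, flagFace p.1) (j, flagFace q.1) (h1 _ _
    ⟨hi, (mem_flags.1 p.2).1, by rw [hip]; simp⟩ ⟨hj, (mem_flags.1 q.2).1, by rw [hjq]; simp⟩)
  simp only [hip, hjq] at this
  rwa [← hs.eq_flagAt, ← hs.eq_flagAt] at this

/-- A triangulation with a one-sided orientable-leaving cycle has odd Euler characteristic. -/
theorem odd_euler (hs : T.IsOrientationSign (cycEdges c) s) (hc : T.IsCycle c)
    (h1 : T.OneSided c) : Odd T.euler := by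
  set c₀ := c.getD 0 0 with hc₀
  have hlen := hc.1
  have hc₀c : c₀ ∈ c := mem_list_iff_getD.2 ⟨0, by omega, rfl⟩
  have hcv : ∀ v ∈ c, v ∈ T.verts := by
    intro v hv
    obtain ⟨i, hi, rfl⟩ := mem_list_iff_getD.1 hv
    obtain ⟨w, hw⟩ := hc.exists_isFace hi
    exact hw.mem_verts
  set f : T.flags s → ℕ := fun x => if x.1.1 ∈ c then c₀ else x.1.1 with hf
  have hinv : ∀ x, f (hs.flagPerm x) = f x := by
    rintro ⟨⟨u, v, w⟩, h⟩
    have h' := hs.rot_mem_flags h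
    rw [hs.flagPerm_apply h h']
    by_cases hE : ({w, u} : Finset ℕ) ∈ cycEdges c
    · rw [hs.crossFun_of_mem hE]
      have h1 := mem_of_mem_cycEdges hE (x := w) (by simp)
      have h2 := mem_of_mem_cycEdges hE (x := u) (by simp)
      simp [hf, h1, h2]
    · obtain ⟨w', -, h1, -, he⟩ := hs.exists_crossFun_eq h' hE
      rw [he]
  have hpow : ∀ (n : ℕ) x, f ((hs.flagPerm ^ n) x) = f x := by
    intro n
    induction n with
    | zero => exact fun _ => rfl
    | succ n ih => exact fun x => by rw [pow_succ', Equiv.Perm.mul_apply, hinv, ih]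
  have hfib : ∀ x y, f x = f y ↔ hs.flagPerm.SameCycle x y := by
    intro x y
    constructor
    · intro he
      by_cases hx : x.1.1 ∈ c <;> by_cases hy : y.1.1 ∈ c
      · exact hs.sameCycle_of_oneSided hc h1 hx hy
      · simp only [hf, hx, hy, if_true, if_false] at he
        exact absurd (he ▸ hc₀c) hy
      · simp only [hf, hx, hy, if_true, if_false] at he
        exact absurd (he ▸ hc₀c) hx
      · simp only [hf, hx, hy, if_false] at he
        exact hs.sameCycle_of_not_mem he fun e he' hxe => hx (mem_of_mem_cycEdges he' hxe)
    · intro h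
      obtain ⟨n, rfl⟩ := h.exists_nat_pow_eq
      rw [hpow]
  have himage : Finset.univ.image f = insert c₀ (T.verts \ c.toFinset) := by
    ext v
    simp only [Finset.mem_image, Finset.mem_univ, true_and, Finset.mem_insert, Finset.mem_sdiff,
      List.mem_toFinset]
    constructor
    · rintro ⟨x, rfl⟩
      by_cases hx : x.1.1 ∈ c
      · simp [hf, hx]
      · right
        simp only [hf, hx, if_false, not_false_eq_true, and_true]
        exact (mem_flags.1 x.2).1.mem_verts
    · intro h
      have hv : v ∈ T.verts := by
        rcases h with rfl | h
        exacts [hcv _ hc₀c, h.1]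
      obtain ⟨g, hg, hvg⟩ := mem_verts.1 hv
      obtain ⟨p, rfl, -⟩ := hs.exists_flag hg hvg
      refine ⟨p, ?_⟩
      rcases h with h | h
      · simp only [hf, h, hc₀c, if_true]
      · simp only [hf, h.2, if_false]
  have hsign := (sign_eq_of_fibers hs.flagPerm_ne hfib).symm.trans (hs.sign_flagPerm hc.2.2)
  rw [himage, Finset.card_insert_of_notMem (by simp [hc₀c]), Fintype.card_coe, hs.card_flags,
    card_cycEdges hc] at hsign
  have hcard : (T.verts \ c.toFinset).card + c.length = T.verts.card := by
    rw [← List.toFinset_card_of_nodup hc.2.1]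
    exact Finset.card_sdiff_add_card_eq_card fun v hv => hcv v (List.mem_toFinset.1 hv)
  have hle : c.length ≤ T.edges.card := by
    rw [← card_cycEdges hc]
    exact Finset.card_le_card hc.2.2
  have hEF := hs.card_flags.symm.trans hs.card_flags_faces
  have hpar : ∀ a b : ℕ, ((-1 : ℤˣ) ^ a = (-1) ^ b) → a % 2 = b % 2 := by
    intro a b hab
    rcases Nat.even_or_odd a with ha | ha <;> rcases Nat.even_or_odd b with hb | hb <;>
      simp only [ha.neg_one_pow, hb.neg_one_pow] at hab
    · rw [Nat.even_iff.1 ha, Nat.even_iff.1 hb]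
    · exact absurd hab (by decide)
    · exact absurd hab (by decide)
    · rw [Nat.odd_iff.1 ha, Nat.odd_iff.1 hb]
  have := hpar _ _ hsign
  rw [Int.odd_iff, euler]
  omega

end IsOrientationSign

/-- A one-sided cycle in a triangulation of even Euler characteristic is not
orientable-leaving. -/
theorem OneSided.not_orientableLeaving (h1 : T.OneSided c) (hc : T.IsCycle c)
    (he : Even T.euler) : ¬ T.OrientableLeaving c := by
  rintro ⟨σ, h2, h3⟩
  obtain ⟨s, hs⟩ := exists_isOrientationSign h2 h3
  exact Int.not_odd_iff_even.2 he (hs.odd_euler hc h1)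

end FlagPerm


section Sides

variable {T : Triangulation} {c : List ℕ} {f g : Finset ℕ} {s : ℕ → ℕ → ℕ → ZMod 2}

theorem SameSide.symm (h : T.SameSide c f g) : T.SameSide c g f := by
  induction h with
  | refl => exact .refl
  | tail _ h ih =>
    obtain ⟨h1, h2, h3, h4⟩ := h
    exact ih.head ⟨h2, h1, by rwa [Finset.inter_comm], by rwa [Finset.inter_comm]⟩

theorem OneSided.not_separating (h : T.OneSided c) : ¬ T.Separating c := by
  rintro ⟨f, hf, g, hg, hfg⟩
  refine hfg ?_
  have key : ∀ x y : ℕ × Finset ℕ, Relation.EqvGen (T.CornerRel c) x y →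
      T.SameSide c x.2 y.2 := by
    intro x y hxy
    induction hxy with
    | rel x y h =>
      obtain ⟨⟨-, hx, -⟩, ⟨-, hy, -⟩, ⟨-, h1, -, h2⟩ | ⟨-, h1, -⟩⟩ := h
      · exact .single ⟨hx, hy, h1, h2⟩
      · rw [h1]
        exact .refl
    | refl x => exact .refl
    | symm x y _ ih => exact ih.symm
    | trans x y z _ _ ih1 ih2 => exact ih1.trans ih2
  refine face_induction (P := T.SameSide c f) hf .refl ?_ hg
  intro u v w w' h1 h2 hw hs
  by_cases hE : ({u, v} : Finset ℕ) ∈ cycEdges c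
  · obtain ⟨i, hi, he⟩ := mem_cycEdges.1 hE
    have hmem : c.getD i 0 ∈ ({u, v} : Finset ℕ) := by rw [← he]; simp
    have hsub : ∀ w, ({u, v} : Finset ℕ) ⊆ {u, v, w} := fun w x => by simp; tauto
    exact hs.trans (key (i, {u, v, w}) (i, {u, v, w'})
      (h _ _ ⟨hi, h1, hsub w hmem⟩ ⟨hi, h2, hsub w' hmem⟩))
  · refine hs.tail ⟨h1, h2, ?_, ?_⟩
    · rw [h1.inter_eq hw, Finset.card_pair h1.ne]
    · rwa [h1.inter_eq hw]

theorem isCycle_face {u v w : ℕ} (h : T.IsFace u v w) : T.IsCycle [u, v, w] := by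
  have h1 := h.ne
  have h2 := h.rot.ne
  have h3 := h.rot.rot.ne
  refine ⟨by simp, by simp [h1, h2, h3.symm], ?_⟩
  intro e he
  obtain ⟨i, hi, rfl⟩ := mem_cycEdges.1 he
  simp only [List.length_cons, List.length_nil] at hi ⊢
  interval_cases i
  · exact pair_mem_edges.2 ⟨w, h⟩
  · exact pair_mem_edges.2 ⟨u, h.rot⟩
  · exact pair_mem_edges.2 ⟨v, h.rot.rot⟩

theorem cycSum_face {M : Type*} [AddCommMonoid M] (m : ℕ → ℕ → M) (u v w : ℕ) :
    cycSum m [u, v, w] = m u v + m v w + m w u := by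
  simp [cycSum, Finset.sum_range_succ]

theorem cycEdges_nonempty (hc : T.IsCycle c) : (cycEdges c).Nonempty := by
  rw [← Finset.card_pos, card_cycEdges hc]
  have := hc.1
  omega

/-- In a nonorientable triangulation some cycle reverses the orientations of vertex stars. -/
theorem IsLocalSign.exists_cycle (hs : T.IsLocalSign s) (hT : ¬ T.Orientable) :
    ∃ c, T.IsCycle c ∧ cycSum (T.edgeSign s) c = 1 := by
  have h2 : ∀ a : ZMod 2, a + a = 0 := by decide
  obtain ⟨f, hf⟩ := T.faces_nonempty
  obtain ⟨u, v, w, rfl, h⟩ := exists_isFace hf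
  have hc := isCycle_face h
  obtain ⟨p, hp⟩ := hc.isGood (m := T.edgeSign s) h2 hs.edgeSign_comm
  rw [cycSum_face, hs.edgeSign_face h] at hp
  rcases hp.potential_or_cycles (cycEdges_nonempty hc) h2 hs.edgeSign_comm
    (fun u v w h => hs.edgeSign_face h) with ⟨q, hq⟩ | ⟨t, ht, hcyc⟩
  · refine absurd ?_ hT
    refine IsOrientationSign.orientable (s := fun u v w => s u v w + q u) ⟨?_, ?_, ?_⟩
    · intro u v w h
      have h1 := hq u v w h
      rw [AddSubgroup.zmultiples_zero_eq_bot, AddSubgroup.mem_bot, hs.edgeSign_eq h] at h1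
      have : ∀ a b d e : ZMod 2, a + b + d + e = 0 → b + e = a + d := by decide
      exact this _ _ _ _ h1
    · intro u v w h
      have h1 := hq u v w h
      rw [AddSubgroup.zmultiples_zero_eq_bot, AddSubgroup.mem_bot, hs.edgeSign_eq h] at h1
      rw [hs.flip h.rot]
      have : ∀ a b d e : ZMod 2, a + b + d + e = 0 → b + 1 + e = a + d + 1 := by decide
      exact this _ _ _ _ h1
    · intro u v w w' h h' hw _
      rw [hs.ne_third h h' hw, add_right_comm]
  · obtain ⟨c, hc, hsum⟩ := hcyc 0 (zero_mem _)
    refine ⟨c, hc, ?_⟩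
    rw [hsum, add_zero]
    rw [AddSubgroup.zmultiples_zero_eq_bot, AddSubgroup.mem_bot] at ht
    have : ∀ t : ZMod 2, t ≠ 0 → t = 1 := by decide
    exact this t ht

theorem exists_oneSided (hT : ¬ T.Orientable) : ∃ c, T.IsCycle c ∧ T.OneSided c := by
  obtain ⟨s, hs⟩ := T.exists_isLocalSign
  obtain ⟨c, hc, hsum⟩ := hs.exists_cycle hT
  exact ⟨c, hc, hs.oneSided hc hsum⟩

end Sides

section Chains

variable {T : Triangulation} {c : List ℕ} {s : ℕ → ℕ → ℕ → ZMod 2} {u v w w' : ℕ}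

/-- The mod 2 boundary map from chains of edges to chains of vertices. -/
noncomputable def edgeBoundary (T : Triangulation) :
    (T.edges → ZMod 2) →ₗ[ZMod 2] (T.verts → ZMod 2) :=
  LinearMap.pi fun v => ∑ e : T.edges with v.1 ∈ e.1, LinearMap.proj e

/-- The mod 2 boundary map from chains of faces to chains of edges. -/
noncomputable def faceBoundary (T : Triangulation) :
    (T.faces → ZMod 2) →ₗ[ZMod 2] (T.edges → ZMod 2) :=
  LinearMap.pi fun e => ∑ f : T.faces with e.1 ⊆ f.1, LinearMap.proj f

theorem edgeBoundary_apply (x : T.edges → ZMod 2) (v : T.verts) :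
    T.edgeBoundary x v = ∑ e : T.edges with v.1 ∈ e.1, x e := by
  simp [edgeBoundary]

theorem faceBoundary_apply (h : T.faces → ZMod 2) (e : T.edges) :
    T.faceBoundary h e = ∑ f : T.faces with e.1 ⊆ f.1, h f := by
  simp [faceBoundary]

theorem faceBoundary_pair (h : T.faces → ZMod 2) (hf : T.IsFace u v w) (hf' : T.IsFace u v w')
    (hw : w ≠ w') (he : ({u, v} : Finset ℕ) ∈ T.edges) :
    T.faceBoundary h ⟨{u, v}, he⟩ = h ⟨{u, v, w}, hf⟩ + h ⟨{u, v, w'}, hf'⟩ := by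
  rw [faceBoundary_apply]
  have : (Finset.univ.filter fun f : T.faces => ({u, v} : Finset ℕ) ⊆ f.1) =
      {⟨{u, v, w}, hf⟩, ⟨{u, v, w'}, hf'⟩} := by
    ext f
    have := congrArg (f.1 ∈ ·) (filter_pair_subset hf hf' hw)
    simpa [Subtype.ext_iff] using this
  rw [this, Finset.sum_pair]
  exact fun he => hw (hf.third_eq_of_eq (congrArg Subtype.val he))

theorem edgeBoundary_faceBoundary (h : T.faces → ZMod 2) :
    T.edgeBoundary (T.faceBoundary h) = 0 := by
  have key : T.edgeBoundary ∘ₗ T.faceBoundary = 0 := by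
    refine LinearMap.pi_ext fun f x => ?_
    ext v
    obtain ⟨f, hf⟩ := f
    simp only [LinearMap.comp_apply, LinearMap.zero_apply, Pi.zero_apply, edgeBoundary_apply,
      faceBoundary_apply]
    have h1 : ∀ e : T.edges, (∑ g : T.faces with e.1 ⊆ g.1,
        (Pi.single (⟨f, hf⟩ : T.faces) x : T.faces → ZMod 2) g) = if e.1 ⊆ f then x else 0 := by
      intro e
      rw [Finset.sum_filter, Finset.sum_eq_single ⟨f, hf⟩]
      · simp
      · intro g _ hg
        simp [hg]
      · simp
    simp only [h1]
    rw [← Finset.sum_filter, Finset.filter_filter, Finset.sum_const]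
    by_cases hv : v.1 ∈ f
    · obtain ⟨a, b, rfl, h⟩ := exists_isFace_of_mem hf hv
      have : (Finset.univ.filter fun e : T.edges => v.1 ∈ e.1 ∧ e.1 ⊆ {v.1, a, b}) =
          {⟨{v.1, a}, pair_mem_edges.2 ⟨b, h⟩⟩, ⟨{v.1, b}, pair_mem_edges.2 ⟨a, h.flip⟩⟩} := by
        ext ⟨e, he⟩
        simp only [Finset.mem_filter, Finset.mem_univ, true_and, Finset.mem_insert,
          Finset.mem_singleton, Subtype.mk.injEq]
        constructor
        · rintro ⟨h1, h2⟩
          obtain ⟨y, hy⟩ : ∃ y, e = {v.1, y} := by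
            obtain ⟨p, q, -, rfl, -⟩ := exists_pair_of_mem_edges he
            simp only [Finset.mem_insert, Finset.mem_singleton] at h1
            rcases h1 with h1 | h1
            · exact ⟨q, by rw [h1]⟩
            · exact ⟨p, by rw [h1, Finset.pair_comm]⟩
          subst hy
          have h3 : y ∈ ({v.1, a, b} : Finset ℕ) := h2 (by simp)
          have h4 : v.1 ≠ y := by
            rintro rfl
            have := (mem_edges.1 he).1
            simp at this
          simp only [Finset.mem_insert, Finset.mem_singleton] at h3
          rcases h3 with h3 | rfl | rfl
          · exact absurd h3.symm h4
          · exact Or.inl rfl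
          · exact Or.inr rfl
        · rintro (rfl | rfl)
          · exact ⟨by simp, by intro x; simp; tauto⟩
          · exact ⟨by simp, by intro x; simp; tauto⟩
      rw [this, Finset.card_pair, two_smul]
      · exact CharTwo.add_self_eq_zero x
      · simp only [ne_eq, Subtype.mk.injEq]
        intro he
        have h5 : a ∈ ({v.1, b} : Finset ℕ) := by rw [← he]; simp
        simp only [Finset.mem_insert, Finset.mem_singleton] at h5
        rcases h5 with h5 | h5
        exacts [h.ne h5.symm, h.rot.ne h5]
    · rw [Finset.filter_false_of_mem]
      · simp
      · rintro e - ⟨h1, h2⟩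
        exact hv (h2 h1)
  exact LinearMap.congr_fun key h

theorem range_faceBoundary_le : LinearMap.range T.faceBoundary ≤ LinearMap.ker T.edgeBoundary := by
  rintro _ ⟨h, rfl⟩
  exact edgeBoundary_faceBoundary h

theorem finrank_span_singleton_le {V : Type*} [AddCommGroup V] [Module (ZMod 2) V] (x : V) :
    Module.finrank (ZMod 2) (Submodule.span (ZMod 2) {x}) ≤ 1 := by
  simpa using finrank_span_le_card (R := ZMod 2) ({x} : Set V)

theorem card_faces_le :
    T.faces.card ≤ Module.finrank (ZMod 2) (LinearMap.range T.faceBoundary) + 1 := by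
  have h1 := T.faceBoundary.finrank_range_add_finrank_ker
  rw [Module.finrank_fintype_fun_eq_card, Fintype.card_coe] at h1
  have h2 : LinearMap.ker T.faceBoundary ≤ Submodule.span (ZMod 2) {fun _ => 1} := by
    intro h hh
    rw [LinearMap.mem_ker] at hh
    obtain ⟨f, hf⟩ := T.faces_nonempty
    rw [Submodule.mem_span_singleton]
    refine ⟨h ⟨f, hf⟩, ?_⟩
    ext ⟨g, hg⟩
    have := face_induction (P := fun g => ∀ hg : g ∈ T.faces, h ⟨g, hg⟩ = h ⟨f, hf⟩) hf
      (fun _ => rfl) ?_ hg hg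
    · simpa using this.symm
    · intro u v w w' h1 h2 hw h3 h4
      rw [← h3 h1]
      have h5 := faceBoundary_pair h h1 h2 hw (pair_mem_edges.2 ⟨w, h1⟩)
      rw [hh] at h5
      have : ∀ a b : ZMod 2, 0 = a + b → b = a := by decide
      exact this _ _ h5
  have h3 := (Submodule.finrank_mono h2).trans (finrank_span_singleton_le _)
  omega

theorem edgeBoundary_single {e : Finset ℕ} (he : e ∈ T.edges) (x : ZMod 2) (v : T.verts) :
    T.edgeBoundary (Pi.single ⟨e, he⟩ x) v = if v.1 ∈ e then x else 0 := by
  rw [edgeBoundary_apply, Finset.sum_filter, Finset.sum_eq_single ⟨e, he⟩]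
  · simp
  · intro g _ hg
    simp [hg]
  · simp

theorem card_verts_le :
    T.verts.card ≤ Module.finrank (ZMod 2) (LinearMap.range T.edgeBoundary) + 1 := by
  obtain ⟨f, hf⟩ := T.faces_nonempty
  obtain ⟨u₀, v₀, w₀, rfl, h⟩ := exists_isFace hf
  set d : ℕ → T.verts → ZMod 2 := fun u v => if v.1 = u then 1 else 0 with hd
  set U := LinearMap.range T.edgeBoundary ⊔ Submodule.span (ZMod 2) {d u₀} with hU
  have hedge : ∀ {u v w}, T.IsFace u v w → d u ∈ U → d v ∈ U := by
    intro u v w h hu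
    have he : ({u, v} : Finset ℕ) ∈ T.edges := pair_mem_edges.2 ⟨w, h⟩
    have h1 : d v = T.edgeBoundary (Pi.single ⟨{u, v}, he⟩ 1) + d u := by
      ext x
      have := h.ne
      rw [Pi.add_apply, edgeBoundary_single]
      simp only [hd, Finset.mem_insert, Finset.mem_singleton]
      by_cases h1 : x.1 = u
      · have h2 : x.1 ≠ v := fun h2 => this (h1.symm.trans h2)
        simp [h1, this]
        decide
      · simp [h1]
    rw [h1]
    exact U.add_mem (Submodule.mem_sup_left ⟨_, rfl⟩) hu
  have hface : ∀ {u v w}, T.IsFace u v w → d u ∈ U → ∀ x ∈ ({u, v, w} : Finset ℕ), d x ∈ U := by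
    intro u v w h hu x hx
    simp only [Finset.mem_insert, Finset.mem_singleton] at hx
    rcases hx with rfl | rfl | rfl
    exacts [hu, hedge h hu, hedge h.flip hu]
  have hall : ∀ g ∈ T.faces, ∀ x ∈ g, d x ∈ U := fun g hg =>
    face_induction (P := fun g => ∀ x ∈ g, d x ∈ U) hf
      (hface h (Submodule.mem_sup_right (Submodule.mem_span_singleton_self _)))
      (fun u v w w' _ h2 _ h4 => hface h2 (h4 u (by simp))) hg
  have htop : U = ⊤ := by
    rw [eq_top_iff]
    intro x _
    have : x = ∑ v : T.verts, x v • d v.1 := by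
      ext v
      simp [hd, Finset.sum_apply]
    rw [this]
    refine U.sum_mem fun v _ => U.smul_mem _ ?_
    obtain ⟨g, hg, hvg⟩ := mem_verts.1 v.2
    exact hall g hg _ hvg
  have h1 := Submodule.finrank_add_le_finrank_add_finrank (LinearMap.range T.edgeBoundary)
    (Submodule.span (ZMod 2) {d u₀})
  rw [← hU, htop, finrank_top, Module.finrank_fintype_fun_eq_card, Fintype.card_coe] at h1
  have h2 := finrank_span_singleton_le (d u₀)
  omega

theorem finrank_ker_le : (Module.finrank (ZMod 2) (LinearMap.ker T.edgeBoundary) : ℤ) ≤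
    Module.finrank (ZMod 2) (LinearMap.range T.faceBoundary) + 2 - T.euler := by
  have h1 := T.edgeBoundary.finrank_range_add_finrank_ker
  rw [Module.finrank_fintype_fun_eq_card, Fintype.card_coe] at h1
  have h2 := T.card_verts_le
  have h3 := T.card_faces_le
  rw [euler]
  omega

end Chains


section Homology

variable {T : Triangulation} {c : List ℕ} {s : ℕ → ℕ → ℕ → ZMod 2} {u v w w' : ℕ}

/-- The mod 2 chain of the edges of `T` that belong to `E`. -/
noncomputable def edgeChain (T : Triangulation) (E : Finset (Finset ℕ)) : T.edges → ZMod 2 :=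
  fun e => if e.1 ∈ E then 1 else 0

theorem edgeChain_singleton {e : Finset ℕ} (he : e ∈ T.edges) :
    T.edgeChain {e} = Pi.single ⟨e, he⟩ 1 := by
  ext x
  by_cases hx : x = ⟨e, he⟩
  · simp [edgeChain, hx]
  · have : x.1 ≠ e := fun h => hx (Subtype.ext h)
    simp [edgeChain, hx, this]

theorem sum_edgeChain_singleton (E : Finset (Finset ℕ)) :
    ∑ e ∈ E, T.edgeChain {e} = T.edgeChain E := by
  ext x
  simp [edgeChain, Finset.sum_apply]

theorem edgeBoundary_cycle (hc : T.IsCycle c) {x : T.edges → ZMod 2}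
    (hx : ∀ e : T.edges, e.1 ∉ cycEdges c → x e = 0) {j : ℕ} (hj : j < c.length)
    (hv : c.getD ((j + 1) % c.length) 0 ∈ T.verts) :
    T.edgeBoundary x ⟨_, hv⟩ = x ⟨_, hc.2.2 _ (pair_mem_cycEdges hj)⟩ +
      x ⟨_, hc.2.2 _ (pair_mem_cycEdges (Nat.mod_lt (j + 1) (by omega)))⟩ := by
  have hj' : (j + 1) % c.length < c.length := Nat.mod_lt _ (by omega)
  rw [edgeBoundary_apply, ← Finset.sum_pair]
  · symm
    refine Finset.sum_subset ?_ ?_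
    · intro e he
      simp only [Finset.mem_insert, Finset.mem_singleton] at he
      rcases he with rfl | rfl <;> simp
    · intro e he hne
      refine hx e fun hmem => hne ?_
      obtain ⟨i, hi, hie⟩ := mem_cycEdges.1 hmem
      have he' := (Finset.mem_filter.1 he).2
      rw [← hie, Finset.mem_insert, Finset.mem_singleton] at he'
      rcases he' with h | h
      · have := getD_inj hc.2.1 hj' hi h
        subst this
        simp [Subtype.ext_iff, ← hie]
      · have h1 := getD_inj hc.2.1 hj' (Nat.mod_lt _ (by omega)) h
        have : j = i := by
          rcases succ_mod_cases hi with h4 | h4 <;> rcases succ_mod_cases hj with h5 | h5 <;> omega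
        subst this
        simp [Subtype.ext_iff, ← hie]
  · intro he
    have h1 := cycle_pair_injOn hc.2.1 hc.1 (by simpa using hj) (by simpa using hj')
      (congrArg Subtype.val he)
    have := hc.1
    rcases succ_mod_cases hj with h5 | h5 <;> omega

theorem edgeChain_mem_ker (hc : T.IsCycle c) :
    T.edgeChain (cycEdges c) ∈ LinearMap.ker T.edgeBoundary := by
  rw [LinearMap.mem_ker]
  ext v
  by_cases hv : v.1 ∈ c
  · obtain ⟨v, hvT⟩ := v
    obtain ⟨i, hi, rfl⟩ := mem_list_iff_getD.1 hv
    obtain ⟨j, hj, rfl⟩ := exists_pred_mod hi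
    rw [edgeBoundary_cycle hc (fun e he => by simp [edgeChain, he]) hj hvT]
    simp only [edgeChain, pair_mem_cycEdges hj, pair_mem_cycEdges hi, if_true]
    rfl
  · rw [edgeBoundary_apply]
    refine Finset.sum_eq_zero fun e he => ?_
    have : e.1 ∉ cycEdges c := fun h => hv (mem_of_mem_cycEdges h (Finset.mem_filter.1 he).2)
    simp [edgeChain, this]

/-- The only nonzero mod 2 cycle supported on the edges of a cycle is the sum of all of them. -/
theorem eq_zero_or_eq_edgeChain (hc : T.IsCycle c) {x : T.edges → ZMod 2}
    (hx : ∀ e : T.edges, e.1 ∉ cycEdges c → x e = 0) (hker : T.edgeBoundary x = 0) :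
    x = 0 ∨ x = T.edgeChain (cycEdges c) := by
  have h0 : 0 < c.length := by have := hc.1; omega
  set a := x ⟨_, hc.2.2 _ (pair_mem_cycEdges h0)⟩ with ha
  have hall : ∀ i, ∀ hi : i < c.length, x ⟨_, hc.2.2 _ (pair_mem_cycEdges hi)⟩ = a := by
    intro i
    induction i with
    | zero => intro _; rfl
    | succ i ih =>
      intro hi
      obtain ⟨w, hw⟩ := hc.exists_isFace (i := i) (by omega)
      have h1 := edgeBoundary_cycle hc hx (j := i) (by omega) hw.swap.mem_verts
      rw [hker, ih (by omega)] at h1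
      simp only [Nat.mod_eq_of_lt hi] at h1
      have : ∀ p q : ZMod 2, 0 = p + q → q = p := by decide
      exact this _ _ h1
  have hform : ∀ e : T.edges, x e = if e.1 ∈ cycEdges c then a else 0 := by
    intro e
    split_ifs with he
    · obtain ⟨i, hi, hie⟩ := mem_cycEdges.1 he
      rw [← hall i hi]
      congr 1
      exact Subtype.ext hie.symm
    · exact hx e he
  have : ∀ a : ZMod 2, a = 0 ∨ a = 1 := by decide
  rcases this a with h | h
  · left
    ext e
    rw [hform, h]
    simp
  · right
    ext e
    rw [hform, h]
    rfl

theorem separating_of_mem_range (hc : T.IsCycle c)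
    (h : T.edgeChain (cycEdges c) ∈ LinearMap.range T.faceBoundary) : T.Separating c := by
  obtain ⟨h, hh⟩ := h
  by_contra hsep
  unfold Separating at hsep
  push Not at hsep
  have hconst : ∀ f (hf : f ∈ T.faces) g, T.SameSide c f g →
      ∃ hg : g ∈ T.faces, h ⟨f, hf⟩ = h ⟨g, hg⟩ := by
    intro f hf g hfg
    induction hfg with
    | refl => exact ⟨hf, rfl⟩
    | tail _ hstep ih =>
      obtain ⟨h1, h2, h3, h4⟩ := hstep
      obtain ⟨_, ih⟩ := ih
      obtain ⟨u, v, w, w', rfl, rfl, h5, h6, hw, he⟩ := exists_of_card_inter h1 h2 h3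
      refine ⟨h2, ih.trans ?_⟩
      have h7 := faceBoundary_pair h h5 h6 hw (pair_mem_edges.2 ⟨w, h5⟩)
      rw [he] at h4
      rw [hh] at h7
      simp only [edgeChain, h4, if_false] at h7
      have : ∀ p q : ZMod 2, 0 = p + q → p = q := by decide
      exact this _ _ h7
  have h0 : 0 < c.length := by have := hc.1; omega
  obtain ⟨w, h1⟩ := hc.exists_isFace h0
  obtain ⟨w', hw, h2⟩ := h1.exists_opposite
  obtain ⟨_, h3⟩ := hconst _ h1 _ (hsep _ h1 _ h2)
  have h4 := faceBoundary_pair h h1 h2 hw.symm (pair_mem_edges.2 ⟨w, h1⟩)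
  rw [hh, h3, CharTwo.add_self_eq_zero] at h4
  simp only [edgeChain, pair_mem_cycEdges h0, if_true] at h4
  exact one_ne_zero h4

theorem Separating.mem_range (h : T.Separating c) (hc : T.IsCycle c) :
    T.edgeChain (cycEdges c) ∈ LinearMap.range T.faceBoundary := by
  obtain ⟨f, hf, g, hg, hfg⟩ := h
  set h : T.faces → ZMod 2 := fun x => if T.SameSide c f x.1 then 1 else 0 with hh
  have key : ∀ {u v w w'} (h1 : T.IsFace u v w) (h2 : T.IsFace u v w'), w ≠ w' →
      ({u, v} : Finset ℕ) ∉ cycEdges c → T.SameSide c f {u, v, w} → T.SameSide c f {u, v, w'} := by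
    intro u v w w' h1 h2 hw hE hs
    refine hs.tail ⟨h1, h2, ?_, ?_⟩
    · rw [h1.inter_eq hw, Finset.card_pair h1.ne]
    · rwa [h1.inter_eq hw]
  have hx : ∀ e : T.edges, e.1 ∉ cycEdges c → T.faceBoundary h e = 0 := by
    rintro ⟨e, he⟩ hE
    obtain ⟨u, v, w, rfl, h1⟩ := exists_pair_of_mem_edges he
    obtain ⟨w', hw, h2⟩ := h1.exists_opposite
    rw [faceBoundary_pair h h1 h2 hw.symm]
    have : T.SameSide c f {u, v, w} ↔ T.SameSide c f {u, v, w'} :=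
      ⟨key h1 h2 hw.symm hE, key h2 h1 hw hE⟩
    simp only [hh, this]
    exact CharTwo.add_self_eq_zero _
  rcases eq_zero_or_eq_edgeChain hc hx (edgeBoundary_faceBoundary h) with h0 | h0
  · refine absurd (face_induction (P := T.SameSide c f) hf .refl ?_ hg) hfg
    intro u v w w' h1 h2 hw hs
    have h3 := faceBoundary_pair h h1 h2 hw (pair_mem_edges.2 ⟨w, h1⟩)
    rw [h0] at h3
    by_contra hs'
    simp [hh, hs, hs'] at h3
  · exact ⟨h, h0⟩

/-- The chain `D` marks the edges across which the orientations of faces recorded by `s`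
disagree. -/
structure IsDefect (T : Triangulation) (s : ℕ → ℕ → ℕ → ZMod 2) (D : T.edges → ZMod 2) : Prop where
  sign : T.IsOrientationSign T.edges s
  eq : ∀ {u v w w'} (_ : T.IsFace u v w) (_ : T.IsFace u v w') (_ : w ≠ w')
    (he : ({u, v} : Finset ℕ) ∈ T.edges), D ⟨{u, v}, he⟩ = 1 + s u v w + s u v w'

theorem exists_isDefect (T : Triangulation) : ∃ s D, T.IsDefect s D := by
  set o : ℕ → ℕ → ZMod 2 := fun u v => if u < v then 1 else 0 with ho
  have hoc : ∀ {u v}, u ≠ v → o v u = o u v + 1 := by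
    intro u v huv
    rcases lt_or_gt_of_ne huv with h | h
    · simp only [ho, h, h.le.not_gt, if_true, if_false]
      decide
    · simp [ho, h, h.le.not_gt]
  have hs : T.IsOrientationSign T.edges fun u v w => o u v + o v w + o w u := by
    refine ⟨?_, ?_, ?_⟩
    · intro u v w h
      ring
    · intro u v w h
      rw [hoc h.ne, hoc h.rot.ne, hoc h.rot.rot.ne]
      have : ∀ a b d : ZMod 2, a + 1 + (d + 1) + (b + 1) = a + b + d + 1 := by decide
      exact this _ _ _
    · intro u v w w' h _ _ hE
      exact absurd (pair_mem_edges.2 ⟨w, h⟩) hE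
  have key : ∀ e : T.edges, ∃ x : ZMod 2, ∀ u v w w', e.1 = {u, v} → T.IsFace u v w →
      T.IsFace u v w' → w ≠ w' →
        x = 1 + (o u v + o v w + o w u) + (o u v + o v w' + o w' u) := by
    rintro ⟨e, he⟩
    obtain ⟨a, b, d, rfl, h⟩ := exists_pair_of_mem_edges he
    obtain ⟨d', hd, h'⟩ := h.exists_opposite
    refine ⟨1 + (o a b + o b d + o d a) + (o a b + o b d' + o d' a), ?_⟩
    have main : ∀ w w', T.IsFace a b w → T.IsFace a b w' → w ≠ w' →
        1 + (o a b + o b d + o d a) + (o a b + o b d' + o d' a) =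
          1 + (o a b + o b w + o w a) + (o a b + o b w' + o w' a) := by
      intro w w' h1 h2 hw
      rcases h.eq_or_eq h' hd.symm h1 with rfl | rfl <;>
        rcases h.eq_or_eq h' hd.symm h2 with rfl | rfl
      · exact absurd rfl hw
      · rfl
      · ring
      · exact absurd rfl hw
    intro u v w w' he' h1 h2 hw
    rcases pair_eq_pair_cases he' with ⟨rfl, rfl⟩ | ⟨rfl, rfl⟩
    · exact main w w' h1 h2 hw
    · rw [main w w' h1.swap h2.swap hw, hs.swap h1, hs.swap h2]
      have : ∀ a b : ZMod 2, 1 + (a + 1) + (b + 1) = 1 + a + b := by decide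
      exact this _ _
  choose D hD using key
  exact ⟨_, D, hs, fun h1 h2 hw he => hD ⟨_, he⟩ _ _ _ _ rfl h1 h2 hw⟩

variable {D : T.edges → ZMod 2}

theorem IsDefect.isOrientationSign (hD : T.IsDefect s D) {E : Finset (Finset ℕ)}
    {h : T.faces → ZMod 2} (hE : T.edgeChain E + D = T.faceBoundary h) :
    T.IsOrientationSign E
      fun u v w => s u v w + if hf : {u, v, w} ∈ T.faces then h ⟨{u, v, w}, hf⟩ else 0 := by
  refine ⟨?_, ?_, ?_⟩
  · intro u v w hf
    have : ({v, w, u} : Finset ℕ) = {u, v, w} := by ext; simp; tauto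
    simp only [this, hD.sign.rot hf]
  · intro u v w hf
    have : ({v, u, w} : Finset ℕ) = {u, v, w} := by ext; simp; tauto
    simp only [this, hD.sign.swap hf]
    ring
  · intro u v w w' h1 h2 hw hne
    have h3 := faceBoundary_pair h h1 h2 hw (pair_mem_edges.2 ⟨w, h1⟩)
    rw [← hE, Pi.add_apply, hD.eq h1 h2 hw] at h3
    simp only [edgeChain, hne, if_false, zero_add] at h3
    have h1' : {u, v, w} ∈ T.faces := h1
    have h2' : {u, v, w'} ∈ T.faces := h2
    simp only [h1', h2', dif_pos]
    have : ∀ a b x y : ZMod 2, 1 + a + b = x + y → b + y = a + x + 1 := by decide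
    exact this _ _ _ _ h3

theorem IsDefect.mem_ker (hD : T.IsDefect s D) : D ∈ LinearMap.ker T.edgeBoundary := by
  obtain ⟨t, ht⟩ := T.exists_isLocalSign
  rw [LinearMap.mem_ker]
  ext ⟨v, hv⟩
  have key : ∀ f : T.faces, ∃ x : ZMod 2, ∀ a b, f.1 = {v, a, b} → x = t v a b + s v a b := by
    rintro ⟨f, hf⟩
    by_cases hvf : v ∈ f
    · obtain ⟨a, b, rfl, h⟩ := exists_isFace_of_mem hf hvf
      refine ⟨t v a b + s v a b, fun d e he => ?_⟩
      have h' : T.IsFace v d e := by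
        unfold IsFace
        rw [← he]
        exact h
      have hn := h'.ne
      have hn' := h'.rot.rot.ne
      have hd : d ∈ ({v, a, b} : Finset ℕ) := by simp only at he; rw [he]; simp
      have he' : e ∈ ({v, a, b} : Finset ℕ) := by simp only at he; rw [he]; simp
      have hde := h'.rot.ne
      simp only [Finset.mem_insert, Finset.mem_singleton] at hd he'
      rcases hd with rfl | rfl | rfl
      · exact absurd rfl hn
      · rcases he' with rfl | rfl | rfl
        · exact absurd rfl hn'
        · exact absurd rfl hde
        · rfl
      · rcases he' with rfl | rfl | rfl
        · exact absurd rfl hn'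
        · rw [ht.flip h, hD.sign.flip h]
          have : ∀ x y : ZMod 2, x + y = x + 1 + (y + 1) := by decide
          exact this _ _
        · exact absurd rfl hde
    · refine ⟨0, fun a b he => absurd ?_ hvf⟩
      simp only at he
      rw [he]
      simp
  choose k hk using key
  have h0 := congrFun (edgeBoundary_faceBoundary k) ⟨v, hv⟩
  rw [Pi.zero_apply] at h0 ⊢
  rw [← h0, edgeBoundary_apply, edgeBoundary_apply]
  refine Finset.sum_congr rfl fun e he => ?_
  obtain ⟨e, heT⟩ := e
  have hve : v ∈ e := (Finset.mem_filter.1 he).2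
  obtain ⟨a, b, rfl, h⟩ : ∃ a b, e = {v, a} ∧ T.IsFace v a b := by
    obtain ⟨p, q, r, rfl, h⟩ := exists_pair_of_mem_edges heT
    simp only [Finset.mem_insert, Finset.mem_singleton] at hve
    rcases hve with rfl | rfl
    · exact ⟨q, r, rfl, h⟩
    · exact ⟨p, r, Finset.pair_comm _ _, h.swap⟩
  obtain ⟨b', hb, h'⟩ := h.exists_opposite
  rw [hD.eq h h' hb.symm, faceBoundary_pair k h h' hb.symm, hk ⟨_, h⟩ a b rfl, hk ⟨_, h'⟩ a b' rfl,
    ht.ne_third h h' hb.symm]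
  have : ∀ x y z : ZMod 2, 1 + y + z = x + y + (x + 1 + z) := by decide
  exact this _ _ _

end Homology

section LinearAlgebra

variable {V : Type*} [AddCommGroup V] [Module (ZMod 2) V]

/-- Over the field with two elements, two vectors independent modulo `B` span a space of
codimension at most two modulo `B`. -/
theorem mem_of_finrank_le [FiniteDimensional (ZMod 2) V] {B Z : Submodule (ZMod 2) V} {a d x : V}
    (hBZ : B ≤ Z) (ha : a ∈ Z) (hd : d ∈ Z) (haB : a ∉ B) (hdB : d ∉ B) (hadB : a + d ∉ B)
    (hZ : Module.finrank (ZMod 2) Z ≤ Module.finrank (ZMod 2) B + 2) (hx : x ∈ Z) :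
    x ∈ B ∨ x + a ∈ B ∨ x + d ∈ B ∨ x + (a + d) ∈ B := by
  have h01 : ∀ r : ZMod 2, r = 0 ∨ r = 1 := by decide
  have h2 : ∀ y : V, y + y = 0 := ZModModule.add_self
  set U := B ⊔ Submodule.span (ZMod 2) {a}
  set W := U ⊔ Submodule.span (ZMod 2) {d}
  have hBU : B < U := by
    refine lt_of_le_of_ne le_sup_left fun h => haB ?_
    rw [h]
    exact Submodule.mem_sup_right (Submodule.mem_span_singleton_self a)
  have hU : ∀ y ∈ U, y ∈ B ∨ y + a ∈ B := by
    intro y hy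
    obtain ⟨b, hb, z, hz, rfl⟩ := Submodule.mem_sup.1 hy
    obtain ⟨r, rfl⟩ := Submodule.mem_span_singleton.1 hz
    rcases h01 r with rfl | rfl
    · left
      simpa using hb
    · right
      rwa [one_smul, add_assoc, h2, add_zero]
  have hUW : U < W := by
    refine lt_of_le_of_ne le_sup_left fun h => ?_
    have hdU : d ∈ U := by
      rw [h]
      exact Submodule.mem_sup_right (Submodule.mem_span_singleton_self d)
    rcases hU d hdU with h | h
    · exact hdB h
    · exact hadB (by rwa [add_comm])
  have hWZ : W ≤ Z := by
    simp only [W, U, sup_le_iff, Submodule.span_singleton_le_iff_mem]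
    exact ⟨⟨hBZ, ha⟩, hd⟩
  have h3 := Submodule.finrank_lt_finrank_of_lt hBU
  have h4 := Submodule.finrank_lt_finrank_of_lt hUW
  rw [← Submodule.eq_of_le_of_finrank_le hWZ (by omega)] at hx
  obtain ⟨y, hy, z, hz, rfl⟩ := Submodule.mem_sup.1 hx
  obtain ⟨r, rfl⟩ := Submodule.mem_span_singleton.1 hz
  rcases h01 r with rfl | rfl
  · rw [zero_smul, add_zero]
    rcases hU y hy with h | h
    · exact Or.inl h
    · exact Or.inr (Or.inl h)
  · rw [one_smul]
    rcases hU y hy with h | h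
    · right; right; left
      rwa [add_assoc, h2, add_zero]
    · right; right; right
      rwa [add_add_add_comm, h2, add_zero]

end LinearAlgebra

section Homology

variable {T : Triangulation} {c : List ℕ} {s : ℕ → ℕ → ℕ → ZMod 2} {D : T.edges → ZMod 2}

theorem cycSum_edgeChain {M : Type*} [AddCommGroup M] [Module (ZMod 2) M]
    (φ : (T.edges → ZMod 2) →ₗ[ZMod 2] M) (hc : T.IsCycle c) :
    cycSum (fun u v => φ (T.edgeChain {{u, v}})) c = φ (T.edgeChain (cycEdges c)) := by
  rw [← sum_edgeChain_singleton, map_sum, sum_cycEdges hc]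
  rfl

theorem edgeChain_face {u v w : ℕ} (h : T.IsFace u v w) :
    T.edgeChain {{u, v}} + T.edgeChain {{v, w}} + T.edgeChain {{w, u}} ∈
      LinearMap.range T.faceBoundary := by
  refine ⟨Pi.single ⟨{u, v, w}, h⟩ 1, ?_⟩
  have h1 := h.ne
  have h2 := h.rot.ne
  have h3 := h.rot.rot.ne
  ext ⟨e, he⟩
  rw [faceBoundary_apply, Finset.sum_filter, Finset.sum_eq_single ⟨{u, v, w}, h⟩]
  · obtain ⟨x, y, z, rfl, hxy⟩ := exists_pair_of_mem_edges he
    have hsub : ({x, y} : Finset ℕ) ⊆ {u, v, w} ↔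
        ({x, y} : Finset ℕ) = {u, v} ∨ ({x, y} : Finset ℕ) = {v, w} ∨
          ({x, y} : Finset ℕ) = {w, u} := by
      constructor
      · intro hs
        have hx : x ∈ ({u, v, w} : Finset ℕ) := hs (by simp)
        have hy : y ∈ ({u, v, w} : Finset ℕ) := hs (by simp)
        have := hxy.ne
        simp only [Finset.mem_insert, Finset.mem_singleton] at hx hy
        rcases hx with rfl | rfl | rfl <;> rcases hy with rfl | rfl | rfl <;>
          simp_all [Finset.pair_comm]
      · rintro (he | he | he) <;> rw [he] <;> intro t <;> simp <;> tauto
    have h4 : ({u, v} : Finset ℕ) ≠ {v, w} := fun he => by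
      rcases pair_eq_pair_cases he with h | h <;> grind
    have h5 : ({u, v} : Finset ℕ) ≠ {w, u} := fun he => by
      rcases pair_eq_pair_cases he with h | h <;> grind
    have h6 : ({v, w} : Finset ℕ) ≠ {w, u} := fun he => by
      rcases pair_eq_pair_cases he with h | h <;> grind
    simp only [Pi.add_apply, edgeChain, Finset.mem_singleton, Pi.single_eq_same, hsub]
    generalize ({x, y} : Finset ℕ) = e
    by_cases e1 : e = {u, v}
    · simp [e1, h4, h5]
    · by_cases e2 : e = {v, w}
      · simp [e2, h4.symm, h6]
      · simp [e1, e2]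
  · intro g _ hg
    simp [hg]
  · simp

/-- If the labels of the edges under `φ` come from a potential modulo `N`, then `φ` maps all mod 2
cycles into `N`. -/
theorem mem_of_potential {M : Type*} [AddCommGroup M] [Module (ZMod 2) M]
    (φ : (T.edges → ZMod 2) →ₗ[ZMod 2] M) {N : AddSubgroup M} {q : ℕ → M}
    (hq : ∀ u v w, T.IsFace u v w → φ (T.edgeChain {{u, v}}) + q u + q v ∈ N)
    {x : T.edges → ZMod 2} (hx : T.edgeBoundary x = 0) : φ x ∈ N := by
  have h2 : ∀ y : M, y + y = 0 := ZModModule.add_self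
  have hsum : x = ∑ e : T.edges, x e • T.edgeChain {e.1} := by
    ext e
    simp [edgeChain, Finset.sum_apply]
  set P : (T.verts → ZMod 2) →ₗ[ZMod 2] M :=
    ∑ v : T.verts, (LinearMap.proj v).smulRight (q v.1) with hP
  have hPd : P (T.edgeBoundary x) = 0 := by rw [hx, map_zero]
  have : φ x = φ x + P (T.edgeBoundary x) := by rw [hPd, add_zero]
  rw [this, hsum]
  simp only [map_sum, map_smul, ← Finset.sum_add_distrib, ← smul_add]
  refine N.sum_mem fun e _ => ?_
  have h01 : ∀ r : ZMod 2, r = 0 ∨ r = 1 := by decide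
  rcases h01 (x e) with h | h
  · rw [h, zero_smul]
    exact N.zero_mem
  rw [h, one_smul]
  obtain ⟨e, he⟩ := e
  obtain ⟨u, v, w, rfl, hf⟩ := exists_pair_of_mem_edges he
  convert hq u v w hf using 1
  rw [add_assoc]
  congr 1
  have hu : (⟨u, hf.mem_verts⟩ : T.verts) ≠ ⟨v, hf.swap.mem_verts⟩ := fun h =>
    hf.ne (congrArg Subtype.val h)
  simp only [hP, LinearMap.sum_apply, LinearMap.smulRight_apply, LinearMap.proj_apply,
    edgeChain_singleton he, edgeBoundary_single]
  rw [← Finset.sum_pair hu (f := fun v => q v.1)]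
  symm
  rw [← Finset.sum_subset (Finset.subset_univ _)]
  · refine Finset.sum_congr rfl fun y hy => ?_
    simp only [Finset.mem_insert, Finset.mem_singleton] at hy
    rcases hy with rfl | rfl <;> simp
  · intro y _ hy
    have : y.1 ∉ ({u, v} : Finset ℕ) := by
      simpa [Subtype.ext_iff] using hy
    simp [this]

end Homology


section Klein

variable {T : Triangulation} {c : List ℕ} {s : ℕ → ℕ → ℕ → ZMod 2} {D : T.edges → ZMod 2}

theorem IsDefect.orientableLeaving (hD : T.IsDefect s D)
    (h : T.edgeChain (cycEdges c) + D ∈ LinearMap.range T.faceBoundary) :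
    T.OrientableLeaving c := by
  obtain ⟨k, hk⟩ := h
  exact (hD.isOrientationSign hk.symm).exists_coherent

theorem IsDefect.not_mem_range (hD : T.IsDefect s D) (hT : ¬ T.Orientable) :
    D ∉ LinearMap.range T.faceBoundary := by
  rintro ⟨k, hk⟩
  refine hT (IsOrientationSign.orientable (hD.isOrientationSign (h := k) ?_))
  rw [hk, ← sum_edgeChain_singleton, Finset.sum_empty, zero_add]

/-- In a nonorientable triangulation of Euler characteristic zero, some cycle represents the
homology class of the edges across which the orientations of faces disagree. -/
theorem IsDefect.exists_cycle (hD : T.IsDefect s D) (hT : ¬ T.Orientable) (he : T.euler = 0) :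
    ∃ c, T.IsCycle c ∧ T.edgeChain (cycEdges c) + D ∈ LinearMap.range T.faceBoundary := by
  obtain ⟨a, ha, ha1⟩ := exists_oneSided hT
  set B := LinearMap.range T.faceBoundary with hB
  have h2 : ∀ y : (T.edges → ZMod 2) ⧸ B, y + y = 0 := ZModModule.add_self
  have hd : D ∉ B := hD.not_mem_range hT
  have had : T.edgeChain (cycEdges a) + D ∉ B := fun h =>
    ha1.not_orientableLeaving ha (by simp [he]) (hD.orientableLeaving h)
  have hab : T.edgeChain (cycEdges a) ∉ B := fun h =>
    ha1.not_separating (separating_of_mem_range ha h)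
  have hfin := T.finrank_ker_le
  rw [he] at hfin
  set m : ℕ → ℕ → (T.edges → ZMod 2) ⧸ B := fun u v => B.mkQ (T.edgeChain {{u, v}}) with hm
  have hmc : ∀ u v, m u v = m v u := fun u v => by simp only [hm, Finset.pair_comm]
  have hface : ∀ u v w, T.IsFace u v w → m u v + m v w + m w u = 0 := by
    intro u v w h
    simp only [hm, ← map_add]
    rw [← LinearMap.mem_ker, Submodule.ker_mkQ]
    exact edgeChain_face h
  have hcyc : ∀ {c}, T.IsCycle c → cycSum m c = B.mkQ (T.edgeChain (cycEdges c)) := fun hc =>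
    cycSum_edgeChain B.mkQ hc
  have hmk : ∀ x y, B.mkQ x = B.mkQ y ↔ x + y ∈ B := by
    intro x y
    rw [← sub_eq_zero, ← map_sub, ← LinearMap.mem_ker, Submodule.ker_mkQ, ZModModule.sub_eq_add]
  obtain ⟨p, hp⟩ := ha.isGood h2 hmc
  rw [hcyc ha] at hp
  rcases hp.potential_or_cycles (cycEdges_nonempty ha) h2 hmc hface with ⟨q, hq⟩ | ⟨t, ht, hc⟩
  · rcases eq_zero_or_eq_of_mem_zmultiples h2 (mem_of_potential B.mkQ hq hD.mem_ker) with h | h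
    · rw [← LinearMap.mem_ker, Submodule.ker_mkQ] at h
      exact absurd h hd
    · rw [hmk, add_comm] at h
      exact absurd h had
  · obtain ⟨c, hc0, hct⟩ := hc 0 (zero_mem _)
    rw [hcyc hc0, add_zero] at hct
    rcases mem_of_finrank_le range_faceBoundary_le (edgeChain_mem_ker ha) hD.mem_ker hab hd had
      (by omega) (edgeChain_mem_ker hc0) with h | h | h | h
    · rw [← hB, ← Submodule.ker_mkQ B, LinearMap.mem_ker, hct] at h
      exact absurd (h ▸ zero_mem _) ht
    · rw [← hmk, hct] at h
      exact absurd (h ▸ AddSubgroup.mem_zmultiples _) ht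
    · exact ⟨c, hc0, h⟩
    · obtain ⟨c', hc', hct'⟩ := hc _ (AddSubgroup.mem_zmultiples _)
      refine ⟨c', hc', ?_⟩
      rw [hcyc hc'] at hct'
      rw [← hmk] at h ⊢
      rw [hct', ← hct, h, map_add, add_right_comm, h2, zero_add]

end Klein

end Triangulation


/-- Every triangulation of the Klein bottle `N_2` has a nonseparating cycle which is
one-sided and nonorientable-leaving, and a nonseparating cycle which is two-sided and
orientable-leaving. -/
theorem every_triangulation_n2_nonseparating :
    ∀ T : Triangulation, T.IsN 2 →
      (∃ c : List ℕ, T.IsCycle c ∧ ¬ T.Separating c ∧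
        T.OneSided c ∧ ¬ T.OrientableLeaving c) ∧
      (∃ c : List ℕ, T.IsCycle c ∧ ¬ T.Separating c ∧
        ¬ T.OneSided c ∧ T.OrientableLeaving c) := by
  rintro T ⟨he, hT⟩
  have he0 : T.euler = 0 := by simpa using he
  have heven : Even T.euler := by simp [he0]
  constructor
  · obtain ⟨c, hc, h1⟩ := Triangulation.exists_oneSided hT
    exact ⟨c, hc, h1.not_separating, h1, h1.not_orientableLeaving hc heven⟩
  · obtain ⟨s, D, hD⟩ := T.exists_isDefect
    obtain ⟨c, hc, hcD⟩ := hD.exists_cycle hT he0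
    have hol := hD.orientableLeaving hcD
    refine ⟨c, hc, fun hsep => ?_, fun h1 => h1.not_orientableLeaving hc heven hol, hol⟩
    refine hD.not_mem_range hT ?_
    have h := Submodule.sub_mem _ hcD (hsep.mem_range hc)
    rwa [add_sub_cancel_left] at h
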